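/- Assume [H1] and [H2]. Then the L^p-solution ψ(t) of the nonlocal Fokker–Planck equation satisfies ψ(t) > 0 for all t ∈ (0, T_max). -/

import Mathlib

open MeasureTheory ENNReal Set Filter

noncomputable section

/-- Ambient space `ℝ × ℝ^m`: the universal cover of the torus `𝕋^{m+1}` (so `n = m + 1`). -/
abbrev Spc (m : ℕ) : Type := ℝ × (Fin m → ℝ)

/-- Unit cube in the last `m` coordinates: a fundamental domain for `𝕋^m`. -/
def cube1 (m : ℕ) : Set (Fin m → ℝ) := Set.pi Set.univ fun _ => Set.Ico (0 : ℝ) 1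

/-- A fundamental domain for the torus `𝕋^{m+1}`. -/
def cube (m : ℕ) : Set (Spc m) := Set.Ico (0 : ℝ) 1 ×ˢ cube1 m

/-- The measure of the torus: Lebesgue measure restricted to a fundamental domain. -/
def μT (m : ℕ) : Measure (Spc m) := volume.restrict (cube m)

/-- `ℤ^{m+1}`-periodicity: `f` is a function on the torus `𝕋^{m+1}`. -/
def IsPeriodic {m : ℕ} (f : Spc m → ℝ) : Prop :=
  ∀ (x : Spc m) (k : ℤ) (j : Fin m → ℤ), f (x.1 + k, fun i => x.2 i + j i) = f x

/-- The first coordinate direction. -/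
def e1 (m : ℕ) : Spc m := (1, 0)

/-- The remaining coordinate directions. -/
def eC (m : ℕ) (i : Fin m) : Spc m := (0, Pi.single i 1)

/-- Partial derivative in the direction `v`. -/
def pd {m : ℕ} (v : Spc m) (f : Spc m → ℝ) (x : Spc m) : ℝ := fderiv ℝ f x v

/-- `∇f ⋅ ∇g`. -/
def gradDot {m : ℕ} (f g : Spc m → ℝ) (x : Spc m) : ℝ :=
  pd (e1 m) f x * pd (e1 m) g x + ∑ i, pd (eC m i) f x * pd (eC m i) g x

/-- The Laplacian. -/
def lap {m : ℕ} (f : Spc m → ℝ) (x : Spc m) : ℝ :=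
  pd (e1 m) (pd (e1 m) f) x + ∑ i, pd (eC m i) (pd (eC m i) f) x

/-- The marginal `ψ̄(x₁) = ∫_{𝕋^m} ψ(x₁, ⋅)`. -/
def marg {m : ℕ} (ψ : Spc m → ℝ) (x1 : ℝ) : ℝ := ∫ y in cube1 m, ψ (x1, y)

/-- The nonlocal coefficient `φ_ψ = (∫ ∂_{x₁}V ψ dx₂…dxₙ) / ψ̄`. -/
def phiF {m : ℕ} (V ψ : Spc m → ℝ) (x1 : ℝ) : ℝ :=
  (∫ y in cube1 m, pd (e1 m) V (x1, y) * ψ (x1, y)) / marg ψ x1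

/-- `F(ψ) = ∇V⋅∇ψ + ΔV ψ − ∂_{x₁}(φ_ψ ψ)`. -/
def Fop {m : ℕ} (V ψ : Spc m → ℝ) (x : Spc m) : ℝ :=
  gradDot V ψ x + lap V x * ψ x - pd (e1 m) (fun z => phiF V ψ z.1 * ψ z) x

/-- `L^p`-norm on the torus. -/
def LpN {m : ℕ} (p : ℝ) (f : Spc m → ℝ) : ℝ≥0∞ := eLpNorm f (ENNReal.ofReal p) (μT m)

/-- Gagliardo (Sobolev–Slobodeckij) seminorm of fractional order `s`. -/
def gagl {m : ℕ} {F : Type*} [NormedAddCommGroup F] (s p : ℝ) (f : Spc m → F) : ℝ≥0∞ :=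
  (∫⁻ x in cube m, ∫⁻ y in cube m,
      ENNReal.ofReal (‖f x - f y‖ ^ p / ‖x - y‖ ^ ((m : ℝ) + 1 + s * p))) ^ (1 / p)

/-- The differential of `f`. -/
def grd {m : ℕ} (f : Spc m → ℝ) (x : Spc m) : Spc m →L[ℝ] ℝ := fderiv ℝ f x

/-- The `W^{σ,p}`-norm on the torus, for `0 ≤ σ ≤ 2`. -/
def WNorm {m : ℕ} (σ p : ℝ) (f : Spc m → ℝ) : ℝ≥0∞ :=
  if σ ≤ 0 then LpN p f
  else if σ < 1 then LpN p f + gagl σ p f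
  else if σ < 2 then
    LpN p f + eLpNorm (fun x => ‖grd f x‖) (ENNReal.ofReal p) (μT m)
      + (if σ = 1 then 0 else gagl (σ - 1) p (grd f))
  else
    LpN p f + eLpNorm (fun x => ‖grd f x‖) (ENNReal.ofReal p) (μT m)
      + eLpNorm (fun x => ‖iteratedFDeriv ℝ 2 f x‖) (ENNReal.ofReal p) (μT m)

/-- Membership in `W^{σ,p}(𝕋^{m+1})`, for `0 ≤ σ ≤ 2`. -/
def MemW {m : ℕ} (σ p : ℝ) (f : Spc m → ℝ) : Prop :=
  IsPeriodic f ∧ Measurable f ∧ (1 ≤ σ → Differentiable ℝ f) ∧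
    (2 ≤ σ → Differentiable ℝ (grd f)) ∧ WNorm σ p f < ⊤

/-- Membership in `𝒟^{σ,p}(𝕋^{m+1}) = {ψ ∈ W^{σ,p} | ψ̄ > 0}`. -/
def MemD {m : ℕ} (σ p : ℝ) (f : Spc m → ℝ) : Prop :=
  MemW σ p f ∧ ∀ x1 : ℝ, 0 < marg f x1

/-- Hypothesis `[H₁]`: `ψ₀ ∈ 𝒟^{σ,p}`, `ψ₀ ≥ 0`, `∫ ψ₀ = 1`. -/
def Hyp1 {m : ℕ} (σ p : ℝ) (ψ0 : Spc m → ℝ) : Prop :=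
  MemD σ p ψ0 ∧ (∀ x, 0 ≤ ψ0 x) ∧ (∫ x in cube m, ψ0 x) = 1

/-- Hypothesis `[H₂]`: `n = m + 1 ≥ 2`, `p > n`, `σ ∈ (1 + n/p, 2)`. -/
def Hyp2 (m : ℕ) (σ p : ℝ) : Prop :=
  1 ≤ m ∧ (m : ℝ) + 1 < p ∧ 1 + ((m : ℝ) + 1) / p < σ ∧ σ < 2

/-- The real interval `[0, Tmax)`, where `Tmax ∈ (0, ∞]`. -/
def Ico0 (Tmax : ℝ≥0∞) : Set ℝ := {t : ℝ | 0 ≤ t ∧ ENNReal.ofReal t < Tmax}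

/-- The real interval `(0, Tmax)`, where `Tmax ∈ (0, ∞]`. -/
def Ioo0 (Tmax : ℝ≥0∞) : Set ℝ := {t : ℝ | 0 < t ∧ ENNReal.ofReal t < Tmax}

/-- Continuity in `W^{σ,p}`-norm of a curve, on a time set `s`. -/
def ContW {m : ℕ} (σ p : ℝ) (s : Set ℝ) (ψ : ℝ → Spc m → ℝ) : Prop :=
  ∀ t ∈ s, ∀ ε : ℝ, 0 < ε → ∃ δ > 0, ∀ t' ∈ s, |t' - t| < δ →
    WNorm σ p (fun x => ψ t' x - ψ t x) < ENNReal.ofReal ε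

/-- Hölder continuity (exponent `α`) in `W^{σ,p}`-norm of a curve, on a time set `s`. -/
def HolderW {m : ℕ} (α σ p : ℝ) (s : Set ℝ) (ψ : ℝ → Spc m → ℝ) : Prop :=
  ∃ C : ℝ, ∀ t ∈ s, ∀ t' ∈ s,
    WNorm σ p (fun x => ψ t' x - ψ t x) ≤ ENNReal.ofReal (C * |t' - t| ^ α)

/-- `ψ` is an `L^p`-solution on `[0, Tmax)` of the nonlocal Fokker–Planck equation
`∂ₜψ = div(∇V ψ + β⁻¹∇ψ) − ∂_{x₁}(φ_ψ ψ) = β⁻¹Δψ + F(ψ)`, `ψ(0) = ψ₀`. -/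
structure IsLpSolution {m : ℕ} (V : Spc m → ℝ) (β σ p : ℝ) (ψ0 : Spc m → ℝ)
    (Tmax : ℝ≥0∞) (ψ : ℝ → Spc m → ℝ) : Prop where
  init : ∀ x, ψ 0 x = ψ0 x
  contLp : ContW 0 p (Ico0 Tmax) ψ
  regW2 : ∀ t ∈ Ioo0 Tmax, MemW 2 p (ψ t)
  regD : ∀ t ∈ Ioo0 Tmax, MemD σ p (ψ t)
  eqn : ∀ t ∈ Ioo0 Tmax,
    Tendsto (fun h : ℝ => LpN p
        (fun x => (ψ (t + h) x - ψ t x) / h - (β⁻¹ * lap (ψ t) x + Fop V (ψ t) x)))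
      (nhdsWithin 0 {h : ℝ | h ≠ 0}) (nhds 0)
  derivCont : ContW 0 p (Ioo0 Tmax)
    (fun t x => β⁻¹ * lap (ψ t) x + Fop V (ψ t) x)

/-- A maximal `L^p`-solution: an `L^p`-solution admitting no proper extension. -/
def IsMaximalLpSolution {m : ℕ} (V : Spc m → ℝ) (β σ p : ℝ) (ψ0 : Spc m → ℝ)
    (Tmax : ℝ≥0∞) (ψ : ℝ → Spc m → ℝ) : Prop :=
  IsLpSolution V β σ p ψ0 Tmax ψ ∧ 0 < Tmax ∧
    ∀ (Tmax' : ℝ≥0∞) (ψ' : ℝ → Spc m → ℝ), IsLpSolution V β σ p ψ0 Tmax' ψ' →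
      (∀ t ∈ Ico0 Tmax, ψ' t = ψ t) → Tmax' ≤ Tmax

/-- The Euclidean quadratic form on `Spc m`. -/
def qd {m : ℕ} (z : Spc m) : ℝ := z.1 ^ 2 + ∑ i, z.2 i ^ 2

/-- The heat semigroup `e^{β⁻¹ t Δ}` on the torus, realized by convolution with the Gaussian
heat kernel on the universal cover (and the identity for `t ≤ 0`). -/
def heatSG {m : ℕ} (β t : ℝ) (f : Spc m → ℝ) (x : Spc m) : ℝ :=
  if t ≤ 0 then f x
  else ∫ y : Spc m, (4 * Real.pi * (t / β)) ^ (-((m : ℝ) + 1) / 2) *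
      Real.exp (-qd (x - y) / (4 * (t / β))) * f y

/-- `ψ` is a mild solution of the nonlocal Fokker–Planck equation on `[0, Tmax)`:
`ψ ∈ C([0,Tmax), 𝒟^{σ,p})` and `ψ(t) = e^{β⁻¹tΔ}ψ₀ + ∫₀ᵗ e^{β⁻¹(t−s)Δ} F(ψ(s)) ds`. -/
def IsMildSolution {m : ℕ} (V : Spc m → ℝ) (β σ p : ℝ) (ψ0 : Spc m → ℝ)
    (Tmax : ℝ≥0∞) (ψ : ℝ → Spc m → ℝ) : Prop :=
  (∀ x, ψ 0 x = ψ0 x) ∧ (∀ t ∈ Ico0 Tmax, MemD σ p (ψ t)) ∧ ContW σ p (Ico0 Tmax) ψ ∧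
    ∀ t ∈ Ico0 Tmax, ∀ᵐ x ∂(volume : Measure (Spc m)),
      ψ t x = heatSG β t ψ0 x + ∫ s in Set.Ioc (0 : ℝ) t, heatSG β (t - s) (Fop V (ψ s)) x

/-- A maximal mild solution. -/
def IsMaximalMildSolution {m : ℕ} (V : Spc m → ℝ) (β σ p : ℝ) (ψ0 : Spc m → ℝ)
    (Tmax : ℝ≥0∞) (ψ : ℝ → Spc m → ℝ) : Prop :=
  IsMildSolution V β σ p ψ0 Tmax ψ ∧ 0 < Tmax ∧
    ∀ (Tmax' : ℝ≥0∞) (ψ' : ℝ → Spc m → ℝ), IsMildSolution V β σ p ψ0 Tmax' ψ' →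
      (∀ t ∈ Ico0 Tmax, ψ' t = ψ t) → Tmax' ≤ Tmax

/-- `L^p`-norm on the one-dimensional torus `𝕋`. -/
def LpN1 (p : ℝ) (g : ℝ → ℝ) : ℝ≥0∞ :=
  eLpNorm g (ENNReal.ofReal p) (volume.restrict (Set.Ico (0 : ℝ) 1))

/-- Membership in `L^p₀(𝕋^{m+1})`: periodic, `L^p` and of mean zero. -/
def MemL0 {m : ℕ} (p : ℝ) (f : Spc m → ℝ) : Prop :=
  IsPeriodic f ∧ Measurable f ∧ LpN p f < ⊤ ∧ (∫ x in cube m, f x) = 0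

lemma fp_per_fract {m : ℕ} {f : Spc m → ℝ} (hf : IsPeriodic f) (x : Spc m) :
    f (Int.fract x.1, fun i => Int.fract (x.2 i)) = f x := by
  have := hf x (-⌊x.1⌋) (fun i => -⌊x.2 i⌋)
  rw [← this]
  simp only [Int.fract, Int.cast_neg, sub_eq_add_neg]

lemma fp_fract_mem {m : ℕ} (x : Spc m) :
    ((Int.fract x.1, fun i => Int.fract (x.2 i)) : Spc m) ∈ cube m := by
  refine ⟨⟨Int.fract_nonneg _, Int.fract_lt_one _⟩, ?_⟩
  intro i _
  exact ⟨Int.fract_nonneg _, Int.fract_lt_one _⟩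

lemma fp_cube_sub {m : ℕ} : cube m ⊆ Icc (0 : Spc m) 1 := by
  rintro x ⟨h1, h2⟩
  refine ⟨⟨h1.1, fun i => (h2 i trivial).1⟩, ⟨h1.2.le, fun i => (h2 i trivial).2.le⟩⟩

lemma fp_per_bdd {m : ℕ} {f : Spc m → ℝ} (hf : IsPeriodic f) (hc : Continuous f) :
    ∃ C, 0 ≤ C ∧ ∀ x, |f x| ≤ C := by
  obtain ⟨C, hC⟩ := (isCompact_Icc (a := (0 : Spc m)) (b := 1)).exists_bound_of_continuousOn
    hc.continuousOn
  refine ⟨max C 0, le_max_right _ _, fun x => ?_⟩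
  rw [← fp_per_fract hf x]
  exact (hC _ (fp_cube_sub (fp_fract_mem x))).trans (le_max_left _ _)

lemma fp_cube_ae {m : ℕ} : cube m =ᵐ[volume] Icc (0 : Spc m) 1 := by
  have h : Icc (0 : Spc m) 1 = Icc (0:ℝ) 1 ×ˢ Icc (0 : Fin m → ℝ) 1 := by
    rw [Icc_prod_eq]; rfl
  rw [h]
  refine Measure.set_prod_ae_eq Ico_ae_eq_Icc ?_
  exact Measure.univ_pi_Ico_ae_eq_Icc (f := (0 : Fin m → ℝ)) (g := 1)

lemma fp_cube_meas (m : ℕ) : MeasurableSet (cube m) :=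
  measurableSet_Ico.prod (MeasurableSet.univ_pi fun _ => measurableSet_Ico)

lemma fp_cube1_meas (m : ℕ) : MeasurableSet (cube1 m) :=
  (MeasurableSet.univ_pi fun _ => measurableSet_Ico)

lemma fp_cube1_vol (m : ℕ) : volume (cube1 m) = 1 := by
  simp [cube1, volume_pi_pi]

lemma fp_cube_vol (m : ℕ) : volume (cube m) = 1 := by
  rw [cube, Measure.volume_eq_prod, Measure.prod_prod, fp_cube1_vol]
  simp

instance fp_prob (m : ℕ) : IsProbabilityMeasure (μT m) :=
  ⟨by simp [μT, fp_cube_vol]⟩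

lemma fp_per_pd {m : ℕ} {f : Spc m → ℝ} (hf : IsPeriodic f) (v : Spc m) :
    IsPeriodic (pd v f) := by
  intro x k j
  have h : (fun z : Spc m => f (z + ((k : ℝ), fun i => (j i : ℝ)))) = f := by
    funext z
    exact hf z k j
  have := fderiv_comp_add_right (𝕜 := ℝ) (f := f) (x := x) (((k : ℝ), fun i => (j i : ℝ)) : Spc m)
  rw [h] at this
  unfold pd
  rw [this]
  rfl

lemma fp_ico_mem {m : ℕ} {f : Spc m → ℝ} (hf : IsPeriodic f) (hc : Continuous f)
    (h : ∀ᵐ x ∂(μT m), f x = 0) (x : Spc m) : f x = 0 := by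
  rw [← fp_per_fract hf x]
  have hE : EqOn f (fun _ => 0) (Icc (0 : Spc m) 1) := by
    refine Measure.eqOn_of_ae_eq (μ := volume) ?_ hc.continuousOn continuousOn_const ?_
    · rw [← Measure.restrict_congr_set fp_cube_ae]
      exact h
    · have h : Icc (0 : Spc m) 1 = Icc (0:ℝ) 1 ×ˢ Icc (0 : Fin m → ℝ) 1 := by
        rw [Icc_prod_eq]; rfl
      rw [h, interior_prod_eq, closure_prod_eq, interior_Icc, closure_Ioo (by norm_num),
        ← pi_univ_Icc, interior_pi_set (finite_univ)]
      simp only [interior_Icc]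
      rw [closure_pi_set]
      refine prod_mono le_rfl (pi_mono fun i _ => ?_)
      simp [closure_Ioo]
  exact hE (fp_cube_sub (fp_fract_mem x))

/-- continuous periodic functions are integrable on the torus -/
lemma fp_int {m : ℕ} {f : Spc m → ℝ} (hc : Continuous f) : Integrable f (μT m) := by
  have : IntegrableOn f (Icc (0 : Spc m) 1) := hc.continuousOn.integrableOn_compact isCompact_Icc
  exact this.mono_set fp_cube_sub

lemma fp_div {m : ℕ} (F0 : Spc m → ℝ) (F : Fin m → Spc m → ℝ)
    (hp0 : IsPeriodic F0) (hp : ∀ i, IsPeriodic (F i))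
    (hd0 : Differentiable ℝ F0) (hd : ∀ i, Differentiable ℝ (F i))
    (hi : Integrable (fun x => pd (e1 m) F0 x + ∑ i, pd (eC m i) (F i) x) (μT m)) :
    ∫ x, (pd (e1 m) F0 x + ∑ i, pd (eC m i) (F i) x) ∂(μT m) = 0 := by
  let eL : Spc m ≃L[ℝ] (Fin (m+1) → ℝ) := Fin.consEquivL ℝ (fun _ : Fin (m+1) => ℝ)
  have heL : ∀ x : Spc m, eL x = Fin.cons x.1 x.2 := fun x => rfl
  have hS : ∀ y : Fin (m+1) → ℝ, eL.symm y = (y 0, fun i => y i.succ) := fun x => rfl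
  have hvol : MeasurePreserving eL volume volume := by
    have h := (volume_preserving_piFinSuccAbove (fun _ : Fin (m+1) => ℝ) 0).symm
    have e : (⇑(MeasurableEquiv.piFinSuccAbove (fun _ : Fin (m+1) => ℝ) 0).symm) = ⇑eL := by
      funext x
      rw [heL]
      simp [MeasurableEquiv.piFinSuccAbove, Fin.insertNthEquiv, Fin.insertNth_zero]
    rw [e] at h
    exact h
  have hord : ∀ x y, eL x ≤ eL y ↔ x ≤ y := by
    intro x y
    rw [heL, heL, Fin.cons_le_cons]
    rfl
  let G : Fin (m+1) → Spc m → ℝ := Fin.cons F0 F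
  have hG : ∀ i, Differentiable ℝ (G i) := by
    intro i
    refine Fin.cases ?_ (fun j => ?_) i
    · exact hd0
    · exact hd j
  have hGp : ∀ i, IsPeriodic (G i) := by
    intro i
    refine Fin.cases ?_ (fun j => ?_) i
    · exact hp0
    · exact hp j
  have hres : μT m = volume.restrict (Icc (0 : Spc m) 1) := Measure.restrict_congr_set fp_cube_ae
  rw [hres] at hi ⊢
  rw [integral_divergence_of_hasFDerivAt_off_countable_of_equiv eL hord hvol G
    (fun i x => fderiv ℝ (G i) x) ∅ countable_empty 0 1 zero_le_one
    (fun i => (hG i).continuous.continuousOn) (fun x _ i => (hG i x).hasFDerivAt) _ ?_ hi]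
  · refine Finset.sum_eq_zero fun i _ => ?_
    rw [sub_eq_zero]
    congr 1
    funext x
    have := hGp i (eL.symm (i.insertNth (eL 0 i) x)) (if i = 0 then 1 else 0)
      (fun j => if i = j.succ then 1 else 0)
    rw [← this]
    congr 1
    have h0 : eL 0 = 0 := map_zero _
    have h1 : eL 1 = 1 := by
      rw [heL]; funext j; refine Fin.cases rfl (fun _ => rfl) j
    rw [h0, h1]
    have key : ∀ j, (i.insertNth (1:ℝ) x : Fin (m+1) → ℝ) j
        = (i.insertNth (0:ℝ) x : Fin (m+1) → ℝ) j + if i = j then 1 else 0 := by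
      intro j
      rcases eq_or_ne j i with rfl | hj
      · simp
      · obtain ⟨k, rfl⟩ := Fin.exists_succAbove_eq hj
        simp [hj.symm]
    simp only [hS, Pi.one_apply, Pi.zero_apply]
    rw [Prod.mk.injEq]
    refine ⟨?_, ?_⟩
    · rw [key]; simp
    · funext j; rw [key]; simp
  · intro x
    rw [Fin.sum_univ_succ]
    have a0 : eL.symm (Pi.single 0 1) = e1 m := by
      rw [hS, e1]; ext <;> simp
    have a1 : ∀ i : Fin m, eL.symm (Pi.single i.succ 1) = eC m i := by
      intro i
      rw [hS, eC]; ext j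
      · simp
      · simp [Pi.single_apply]
    simp only [a0, a1]
    rfl

lemma fp_pd_mul {m : ℕ} (v : Spc m) {f g : Spc m → ℝ} (hf : Differentiable ℝ f)
    (hg : Differentiable ℝ g) (x : Spc m) :
    pd v (fun z => f z * g z) x = f x * pd v g x + g x * pd v f x := by
  unfold pd
  rw [fderiv_fun_mul (hf x) (hg x)]
  simp

lemma fp_pd_add {m : ℕ} (v : Spc m) {f g : Spc m → ℝ} (hf : Differentiable ℝ f)
    (hg : Differentiable ℝ g) (x : Spc m) :
    pd v (fun z => f z + g z) x = pd v f x + pd v g x := by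
  unfold pd
  rw [fderiv_fun_add (hf x) (hg x)]
  simp

lemma fp_pd_sub {m : ℕ} (v : Spc m) {f g : Spc m → ℝ} (hf : Differentiable ℝ f)
    (hg : Differentiable ℝ g) (x : Spc m) :
    pd v (fun z => f z - g z) x = pd v f x - pd v g x := by
  unfold pd
  rw [fderiv_fun_sub (hf x) (hg x)]
  simp

lemma fp_pd_const_mul {m : ℕ} (v : Spc m) (c : ℝ) {g : Spc m → ℝ}
    (hg : Differentiable ℝ g) (x : Spc m) :
    pd v (fun z => c * g z) x = c * pd v g x := by
  unfold pd
  rw [fderiv_const_mul (hg x)]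
  simp

lemma fp_pd_comp {m : ℕ} (v : Spc m) {Φ Φ' : ℝ → ℝ} {g : Spc m → ℝ} (x : Spc m)
    (hΦ : HasDerivAt Φ (Φ' (g x)) (g x)) (hg : Differentiable ℝ g) :
    pd v (fun z => Φ (g z)) x = Φ' (g x) * pd v g x := by
  unfold pd
  have := (hΦ.comp_hasFDerivAt x (hg x).hasFDerivAt).fderiv
  change fderiv ℝ (Φ ∘ g) x v = _
  rw [this]
  simp

lemma fp_C1 {m : ℕ} {u : Spc m → ℝ} (hd : Differentiable ℝ u) (hg : Differentiable ℝ (grd u)) :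
    ContDiff ℝ 1 u :=
  contDiff_one_iff_fderiv.2 ⟨hd, hg.continuous⟩

lemma fp_pd_cont {m : ℕ} {u : Spc m → ℝ} (h : ContDiff ℝ 1 u) (v : Spc m) :
    Continuous (pd v u) := by
  have := h.continuous_fderiv (by norm_num)
  exact this.clm_apply continuous_const

lemma fp_pd_diff {m : ℕ} {u : Spc m → ℝ} (hg : Differentiable ℝ (grd u)) (v : Spc m) :
    Differentiable ℝ (pd v u) := by
  have : pd v u = fun x => (grd u x) v := rfl
  rw [this]
  exact hg.clm_apply (differentiable_const _)

lemma fp_pd_C1 {m : ℕ} {V : Spc m → ℝ} (hV : ContDiff ℝ 2 V) (v : Spc m) :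
    ContDiff ℝ 1 (pd v V) := by
  have h : ContDiff ℝ 1 (fderiv ℝ V) := hV.fderiv_right (by norm_num)
  exact h.clm_apply contDiff_const

lemma fp_param_diff {m : ℕ} {f : Spc m → ℝ} (hf : ContDiff ℝ 1 f) :
    Differentiable ℝ (fun x1 : ℝ => ∫ y in cube1 m, f (x1, y)) := by
  intro a
  have hc := hf.continuous
  have hpc := fp_pd_cont hf (e1 m)
  obtain ⟨C, hC⟩ := ((isCompact_Icc (a := a - 1) (b := a + 1)).prod
    (isCompact_Icc (a := (0 : Fin m → ℝ)) (b := 1))).exists_bound_of_continuousOn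
    hpc.continuousOn
  have : IsFiniteMeasure (volume.restrict (cube1 m)) :=
    ⟨by simp [fp_cube1_vol]⟩
  have hsub : cube1 m ⊆ Icc (0 : Fin m → ℝ) 1 := fun y hy =>
    ⟨fun i => (hy i trivial).1, fun i => (hy i trivial).2.le⟩
  have := hasDerivAt_integral_of_dominated_loc_of_deriv_le (μ := volume.restrict (cube1 m))
    (F := fun x1 y => f (x1, y)) (F' := fun x1 y => pd (e1 m) f (x1, y)) (x₀ := a)
    (s := Icc (a-1) (a+1)) (bound := fun _ => C)
    (Icc_mem_nhds (by linarith) (by linarith)) ?_ ?_ ?_ ?_ ?_ ?_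
  · exact this.2.differentiableAt
  · exact Eventually.of_forall fun x => (hc.comp (by fun_prop)).aestronglyMeasurable
  · have : IntegrableOn (fun y => f (a, y)) (Icc (0 : Fin m → ℝ) 1) :=
      (hc.comp (by fun_prop : Continuous fun y : Fin m → ℝ => (a, y))).continuousOn.integrableOn_compact
        isCompact_Icc
    exact this.mono_set hsub
  · exact (hpc.comp (by fun_prop)).aestronglyMeasurable
  · refine (ae_restrict_mem (fp_cube1_meas m)).mono fun y hy x hx => hC _ ⟨hx, hsub hy⟩
  · exact integrable_const _
  · refine Eventually.of_forall fun y x _ => ?_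
    have h1 : HasFDerivAt f (fderiv ℝ f (x, y)) (x, y) :=
      (hf.differentiable (by norm_num) _).hasFDerivAt
    have h2 : HasDerivAt (fun s : ℝ => ((s, y) : Spc m)) (e1 m) x :=
      (hasDerivAt_id x).prodMk (hasDerivAt_const x y)
    exact h1.comp_hasDerivAt x h2

lemma fp_phi_diff {m : ℕ} {V u : Spc m → ℝ} (hV : ContDiff ℝ 2 V) (hu : ContDiff ℝ 1 u)
    (hm : ∀ x1, 0 < marg u x1) : Differentiable ℝ (phiF V u) := by
  intro a
  exact ((fp_param_diff ((fp_pd_C1 hV (e1 m)).mul hu)) a).div (fp_param_diff hu a) (hm a).ne'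

lemma fp_phi_per {m : ℕ} {V u : Spc m → ℝ} (hV : IsPeriodic V) (hu : IsPeriodic u) (x1 : ℝ)
    (k : ℤ) : phiF V u (x1 + k) = phiF V u x1 := by
  have h : ∀ {f : Spc m → ℝ}, IsPeriodic f → ∀ y, f (x1 + k, y) = f (x1, y) := by
    intro f hf y
    simpa using hf (x1, y) k 0
  unfold phiF marg
  simp only [h hu, h (fp_per_pd hV (e1 m))]

lemma fp_phi_bd {m : ℕ} {V u : Spc m → ℝ} (hu : Continuous u)
    (h0 : ∀ x, 0 ≤ u x) (hm : ∀ x1, 0 < marg u x1) {M : ℝ} (hM : ∀ x, |pd (e1 m) V x| ≤ M)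
    (x1 : ℝ) : |phiF V u x1| ≤ M := by
  unfold phiF
  rw [abs_div, abs_of_pos (hm x1), div_le_iff₀ (hm x1)]
  unfold marg
  rw [← integral_const_mul]
  have hsub : cube1 m ⊆ Icc (0 : Fin m → ℝ) 1 := fun y hy =>
    ⟨fun i => (hy i trivial).1, fun i => (hy i trivial).2.le⟩
  have hi : IntegrableOn (fun y => M * u (x1, y)) (cube1 m) := by
    have : IntegrableOn (fun y => M * u (x1, y)) (Icc (0 : Fin m → ℝ) 1) :=
      (by fun_prop : Continuous fun y : Fin m → ℝ => M * u (x1, y)).continuousOn.integrableOn_compact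
        isCompact_Icc
    exact this.mono_set hsub
  rw [← Real.norm_eq_abs]
  refine norm_integral_le_of_norm_le hi (Eventually.of_forall fun y => ?_)
  rw [Real.norm_eq_abs, abs_mul, abs_of_nonneg (h0 _)]
  exact mul_le_mul_of_nonneg_right (hM _) (h0 _)

lemma fp_per_mul {m : ℕ} {f g : Spc m → ℝ} (hf : IsPeriodic f) (hg : IsPeriodic g) :
    IsPeriodic (fun x => f x * g x) := fun x k j => by
  simp only [hf x k j, hg x k j]

lemma fp_per_add {m : ℕ} {f g : Spc m → ℝ} (hf : IsPeriodic f) (hg : IsPeriodic g) :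
    IsPeriodic (fun x => f x + g x) := fun x k j => by
  simp only [hf x k j, hg x k j]

lemma fp_per_sub {m : ℕ} {f g : Spc m → ℝ} (hf : IsPeriodic f) (hg : IsPeriodic g) :
    IsPeriodic (fun x => f x - g x) := fun x k j => by
  simp only [hf x k j, hg x k j]

lemma fp_per_comp {m : ℕ} {f : Spc m → ℝ} (hf : IsPeriodic f) (Φ : ℝ → ℝ) :
    IsPeriodic (fun x => Φ (f x)) := fun x k j => by
  simp only [hf x k j]

lemma fp_per_const {m : ℕ} (c : ℝ) : IsPeriodic (fun _ : Spc m => c) := fun _ _ _ => rfl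

lemma fp_ibp {m : ℕ} {V u w : Spc m → ℝ} {β : ℝ} (hV : ContDiff ℝ 2 V) (hVp : IsPeriodic V)
    (hup : IsPeriodic u) (hud : Differentiable ℝ u) (hug : Differentiable ℝ (grd u))
    (hm : ∀ x1, 0 < marg u x1) (hw : ContDiff ℝ 1 w) (hwp : IsPeriodic w)
    (hi : Integrable (fun x => β⁻¹ * lap u x + Fop V u x) (μT m)) :
    Integrable (fun x => w x * (β⁻¹ * lap u x + Fop V u x)) (μT m) ∧
    Integrable (fun x => β⁻¹ * gradDot w u x + u x * gradDot w V x
        - phiF V u x.1 * u x * pd (e1 m) w x) (μT m) ∧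
    ∫ x, w x * (β⁻¹ * lap u x + Fop V u x) ∂(μT m)
      = - ∫ x, (β⁻¹ * gradDot w u x + u x * gradDot w V x
        - phiF V u x.1 * u x * pd (e1 m) w x) ∂(μT m) := by
  have hu := fp_C1 hud hug
  have hφ := fp_phi_diff hV hu hm
  have hφz : Differentiable ℝ (fun z : Spc m => phiF V u z.1) := hφ.comp differentiable_fst
  have hφp : IsPeriodic (fun z : Spc m => phiF V u z.1) := fun x k j => fp_phi_per hVp hup _ _
  have hwd : Differentiable ℝ w := hw.differentiable (by norm_num)
  have hVd : ∀ v, Differentiable ℝ (pd v V) := fun v => (fp_pd_C1 hV v).differentiable (by norm_num)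
  have hV1 : ContDiff ℝ 1 V := hV.of_le (by norm_num)
  have hud2 : ∀ v, Differentiable ℝ (pd v u) := fp_pd_diff hug
  obtain ⟨C, -, hC⟩ := fp_per_bdd hwp hw.continuous
  have i1 : Integrable (fun x => w x * (β⁻¹ * lap u x + Fop V u x)) (μT m) :=
    hi.bdd_mul hw.continuous.aestronglyMeasurable (Eventually.of_forall hC)
  have hgd : ∀ {g : Spc m → ℝ}, ContDiff ℝ 1 g → Continuous (fun x => gradDot w g x) := by
    intro g hg
    unfold gradDot
    have := fp_pd_cont hw
    have := fp_pd_cont hg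
    fun_prop
  have i2 : Integrable (fun x => β⁻¹ * gradDot w u x + u x * gradDot w V x
        - phiF V u x.1 * u x * pd (e1 m) w x) (μT m) := by
    apply fp_int
    have := hgd hu
    have := hgd hV1
    have := hφz.continuous
    have := hu.continuous
    have := fp_pd_cont hw (e1 m)
    fun_prop
  refine ⟨i1, i2, ?_⟩
  have hJ : ∀ v, Differentiable ℝ (fun x => β⁻¹ * pd v u x + pd v V x * u x) := fun v =>
    ((hud2 v).const_mul _).add ((hVd v).mul hud)
  have hφu : Differentiable ℝ (fun x : Spc m => phiF V u x.1 * u x) := hφz.mul hud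
  have hJp : ∀ v, IsPeriodic (fun x => β⁻¹ * pd v u x + pd v V x * u x) := fun v =>
    fp_per_add (fp_per_mul (fp_per_const _) (fp_per_pd hup v)) (fp_per_mul (fp_per_pd hVp v) hup)
  have hpJ : ∀ v x, pd v (fun x => β⁻¹ * pd v u x + pd v V x * u x) x
      = β⁻¹ * pd v (pd v u) x + pd v V x * pd v u x + u x * pd v (pd v V) x := by
    intro v x
    rw [fp_pd_add v ((hud2 v).const_mul _) ((hVd v).fun_mul hud), fp_pd_const_mul v _ (hud2 v),
      fp_pd_mul v (hVd v) hud, add_assoc]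
  have hdiv := fp_div
    (fun x => w x * ((β⁻¹ * pd (e1 m) u x + pd (e1 m) V x * u x) - phiF V u x.1 * u x))
    (fun i x => w x * (β⁻¹ * pd (eC m i) u x + pd (eC m i) V x * u x))
    (fp_per_mul hwp (fp_per_sub (hJp _) (fp_per_mul hφp hup)))
    (fun i => fp_per_mul hwp (hJp _))
    (hwd.mul ((hJ _).sub hφu)) (fun i => hwd.mul (hJ _))
  have hpt : ∀ x, pd (e1 m) (fun x => w x * ((β⁻¹ * pd (e1 m) u x + pd (e1 m) V x * u x)
        - phiF V u x.1 * u x)) x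
      + ∑ i, pd (eC m i) (fun x => w x * (β⁻¹ * pd (eC m i) u x + pd (eC m i) V x * u x)) x
      = w x * (β⁻¹ * lap u x + Fop V u x) + (β⁻¹ * gradDot w u x + u x * gradDot w V x
        - phiF V u x.1 * u x * pd (e1 m) w x) := by
    intro x
    rw [fp_pd_mul _ hwd ((hJ _).fun_sub hφu), fp_pd_sub _ (hJ _) hφu, hpJ]
    have : ∀ i, pd (eC m i) (fun x => w x * (β⁻¹ * pd (eC m i) u x + pd (eC m i) V x * u x)) x
        = w x * (β⁻¹ * pd (eC m i) (pd (eC m i) u) x)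
          + w x * (pd (eC m i) V x * pd (eC m i) u x)
          + w x * (pd (eC m i) (pd (eC m i) V) x * u x)
          + β⁻¹ * (pd (eC m i) w x * pd (eC m i) u x)
          + u x * (pd (eC m i) w x * pd (eC m i) V x) := by
      intro i
      rw [fp_pd_mul _ hwd (hJ _), hpJ]
      ring
    simp only [this, Finset.sum_add_distrib, ← Finset.mul_sum, ← Finset.sum_mul]
    simp only [Fop, lap, gradDot]
    ring
  simp only [hpt] at hdiv
  rw [integral_add i1 i2] at hdiv
  linarith [hdiv (i1.add i2)]

/-- lower bound for the left Dini derivative -/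
def fp_LD (f : ℝ → ℝ) (τ g : ℝ) : Prop :=
  ∀ ε > 0, ∀ᶠ h in nhdsWithin (0:ℝ) (Ioi 0), (g - ε) * h ≤ f τ - f (τ - h)

lemma fp_LD_mono {f : ℝ → ℝ} {τ g g' : ℝ} (h : fp_LD f τ g) (hg : g' ≤ g) : fp_LD f τ g' := by
  intro ε hε
  filter_upwards [h ε hε, self_mem_nhdsWithin] with k hk hk0
  refine le_trans ?_ hk
  exact mul_le_mul_of_nonneg_right (by linarith) (le_of_lt hk0)

lemma fp_mono {f : ℝ → ℝ} {a b : ℝ} (hab : a ≤ b) (hc : ContinuousOn f (Icc a b))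
    (hd : ∀ τ ∈ Ioc a b, fp_LD f τ 0) : f a ≤ f b := by
  have hg : ContinuousOn (fun x => f (b - x)) (Icc 0 (b - a)) := by
    refine hc.comp (by fun_prop) ?_
    intro x hx
    exact ⟨by linarith [hx.2], by linarith [hx.1]⟩
  have := image_le_of_liminf_slope_right_le_deriv_boundary (f := fun x => f (b - x)) hg
    (B := fun _ => f b) (B' := fun _ => 0) (by simp) continuousOn_const
    (fun x _ => hasDerivWithinAt_const _ _ _) ?_ (right_mem_Icc.2 (sub_nonneg.2 hab))
  · simpa using this
  · intro x hx r hr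
    have h1 := hd (b - x) ⟨by linarith [hx.2], by linarith [hx.1]⟩ (r/2) (by simpa using hr)
    have hr' : 0 < r := hr
    apply Eventually.frequently
    have h2 : Tendsto (fun z => z - x) (nhdsWithin x (Ioi x)) (nhdsWithin 0 (Ioi 0)) := by
      refine tendsto_nhdsWithin_iff.2 ⟨?_, ?_⟩
      · have : Tendsto (fun z => z - x) (nhds x) (nhds (x - x)) := by
          apply Continuous.tendsto (by fun_prop)
        rw [sub_self] at this
        exact this.mono_left nhdsWithin_le_nhds
      · filter_upwards [self_mem_nhdsWithin] with z hz
        exact sub_pos.2 (mem_Ioi.1 hz)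
    filter_upwards [h2.eventually h1, self_mem_nhdsWithin] with z hz hzx
    have hzx' : 0 < z - x := sub_pos.2 hzx
    rw [slope_def_field, div_lt_iff₀ hzx']
    have : b - x - (z - x) = b - z := by ring
    rw [this] at hz
    nlinarith

lemma fp_LD_sub {f H : ℝ → ℝ} {τ g : ℝ} (hf : fp_LD f τ g) (hH : HasDerivAt H g τ) :
    fp_LD (fun s => f s - H s) τ 0 := by
  intro ε hε
  have h1 := hf (ε/2) (by positivity)
  have h2 := (hasDerivAt_iff_isLittleO_nhds_zero.1 hH).def (show 0 < ε/2 by positivity)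
  have h3 : Tendsto (fun h : ℝ => -h) (nhdsWithin 0 (Ioi 0)) (nhds 0) := by
    have : Tendsto (fun h : ℝ => -h) (nhds 0) (nhds (-0)) :=
      Continuous.tendsto (by fun_prop) _
    rw [neg_zero] at this
    exact this.mono_left nhdsWithin_le_nhds
  filter_upwards [h1, h3.eventually h2, self_mem_nhdsWithin] with h a1 a2 a3
  have a3' : 0 < h := a3
  simp only [Real.norm_eq_abs, abs_neg, abs_of_pos a3', smul_eq_mul] at a2
  have := abs_le.1 a2
  have e : τ - h = τ + -h := by ring
  rw [← e] at this
  nlinarith [this.1, this.2]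

lemma fp_mono' {f H g : ℝ → ℝ} {a b : ℝ} (hab : a ≤ b) (hc : ContinuousOn f (Icc a b))
    (hd : ∀ τ ∈ Ioc a b, fp_LD f τ (g τ)) (hHc : ContinuousOn H (Icc a b))
    (hH : ∀ τ ∈ Ioc a b, HasDerivAt H (g τ) τ) : H b - H a ≤ f b - f a := by
  have := fp_mono hab (hc.sub hHc) (fun τ hτ => fp_LD_sub (hd τ hτ) (hH τ hτ))
  simp only [Pi.sub_apply] at this
  linarith

lemma fp_pd_meas {m : ℕ} (v : Spc m) (f : Spc m → ℝ) : Measurable (pd v f) :=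
  measurable_fderiv_apply_const ℝ f v

lemma fp_v_meas {m : ℕ} (β : ℝ) {V u : Spc m → ℝ} (hu : Measurable u) :
    Measurable (fun x => β⁻¹ * lap u x + Fop V u x) := by
  unfold Fop lap gradDot
  have := fun v (f : Spc m → ℝ) => fp_pd_meas v f
  fun_prop

lemma fp_L1 {m : ℕ} {p : ℝ} (hp : 1 ≤ p) {f : Spc m → ℝ} (hf : Measurable f) {ε : ℝ} (hε : 0 ≤ ε)
    (h : LpN p f ≤ ENNReal.ofReal ε) : Integrable f (μT m) ∧ ∫ x, |f x| ∂(μT m) ≤ ε := by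
  have h1 : eLpNorm f 1 (μT m) ≤ ENNReal.ofReal ε :=
    (eLpNorm_le_eLpNorm_of_exponent_le (by simpa using hp) hf.aestronglyMeasurable).trans h
  have hi : Integrable f (μT m) :=
    memLp_one_iff_integrable.1 ⟨hf.aestronglyMeasurable, h1.trans_lt ENNReal.ofReal_lt_top⟩
  refine ⟨hi, ?_⟩
  have := hi.norm
  rw [eLpNorm_one_eq_lintegral_enorm] at h1
  have e := ofReal_integral_norm_eq_lintegral_enorm hi
  rw [← e] at h1
  exact (ENNReal.ofReal_le_ofReal_iff hε).1 h1

/-- Basic facts about the solution, extracted. -/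
structure fp_Sol {m : ℕ} (V : Spc m → ℝ) (β : ℝ) (T : ℝ) (ψ : ℝ → Spc m → ℝ) : Prop where
  cont : ∀ t ∈ Icc 0 T, Continuous (ψ t)
  per : ∀ t ∈ Ioc 0 T, IsPeriodic (ψ t)
  diff : ∀ t ∈ Ioc 0 T, Differentiable ℝ (ψ t)
  diff2 : ∀ t ∈ Ioc 0 T, Differentiable ℝ (grd (ψ t))
  marg : ∀ t ∈ Ioc 0 T, ∀ x1, 0 < marg (ψ t) x1
  init : ∀ x, 0 ≤ ψ 0 x
  intv : ∀ t ∈ Ioc 0 T, Integrable (fun x => β⁻¹ * lap (ψ t) x + Fop V (ψ t) x) (μT m)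
  contL1 : ∀ t ∈ Icc 0 T, ∀ ε > 0, ∃ δ > 0, ∀ t' ∈ Icc 0 T, |t' - t| < δ →
    ∫ x, |ψ t' x - ψ t x| ∂(μT m) ≤ ε
  diffL1 : ∀ t ∈ Ioc 0 T, ∀ ε > 0, ∀ᶠ h in nhdsWithin (0:ℝ) (Ioi 0),
    ∫ x, |ψ t x - ψ (t - h) x - h * (β⁻¹ * lap (ψ t) x + Fop V (ψ t) x)| ∂(μT m) ≤ ε * h

lemma fp_sol {m : ℕ} {V : Spc m → ℝ} {β σ p : ℝ} {ψ0 : Spc m → ℝ}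
    {Tmax : ℝ≥0∞} {ψ : ℝ → Spc m → ℝ}
    (h1 : Hyp1 σ p ψ0) (h2 : Hyp2 m σ p) (hs : IsLpSolution V β σ p ψ0 Tmax ψ)
    {T : ℝ} (hT : T ∈ Ioo0 Tmax) : fp_Sol V β T ψ := by
  have hm : (0:ℝ) ≤ m := Nat.cast_nonneg m
  have hp1 : 1 ≤ p := by linarith [h2.2.1]
  have hσ : 1 ≤ σ := by
    have : 0 ≤ ((m:ℝ)+1)/p := by positivity
    linarith [h2.2.2.1]
  have sub1 : ∀ t ∈ Ioc 0 T, t ∈ Ioo0 Tmax := fun t ht =>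
    ⟨ht.1, (ENNReal.ofReal_le_ofReal ht.2).trans_lt hT.2⟩
  have sub2 : ∀ t ∈ Icc 0 T, t ∈ Ico0 Tmax := fun t ht =>
    ⟨ht.1, (ENNReal.ofReal_le_ofReal ht.2).trans_lt hT.2⟩
  have hcont : ∀ t ∈ Icc 0 T, Continuous (ψ t) := by
    intro t ht
    rcases ht.1.eq_or_lt with h | h
    · have : ψ t = ψ0 := by rw [← h]; funext x; exact hs.init x
      rw [this]
      exact (h1.1.1.2.2.1 hσ).continuous
    · exact ((hs.regW2 t (sub1 t ⟨h, ht.2⟩)).2.2.1 (by norm_num)).continuous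
  have key : ∀ t ∈ Ioc 0 T, ∀ ε > 0, ∀ᶠ h in nhdsWithin (0:ℝ) (Ioi 0),
      Integrable (fun x => β⁻¹ * lap (ψ t) x + Fop V (ψ t) x) (μT m) ∧
      ∫ x, |ψ t x - ψ (t - h) x - h * (β⁻¹ * lap (ψ t) x + Fop V (ψ t) x)| ∂(μT m) ≤ ε * h := by
    intro t ht ε hε
    have hneg : Tendsto (fun h : ℝ => -h) (nhdsWithin 0 (Ioi 0)) (nhdsWithin 0 {h : ℝ | h ≠ 0}) := by
      refine tendsto_nhdsWithin_iff.2 ⟨?_, ?_⟩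
      · have : Tendsto (fun h : ℝ => -h) (nhds 0) (nhds (-0)) :=
          Continuous.tendsto (by fun_prop) _
        rw [neg_zero] at this
        exact this.mono_left nhdsWithin_le_nhds
      · filter_upwards [self_mem_nhdsWithin] with z hz
        exact neg_ne_zero.2 (ne_of_gt hz)
    have hE := (hs.eqn t (sub1 t ht)).comp hneg
    have hE2 := hE.eventually (Iic_mem_nhds (ENNReal.ofReal_pos.2 hε))
    have hlt : ∀ᶠ h in nhdsWithin (0:ℝ) (Ioi 0), h < t :=
      nhdsWithin_le_nhds (Iio_mem_nhds ht.1)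
    filter_upwards [hE2, hlt, self_mem_nhdsWithin] with h a1 a2 a3
    have a3' : 0 < h := a3
    have hth : t - h ∈ Icc 0 T := ⟨by linarith, by linarith [ht.2]⟩
    have e : t + -h = t - h := by ring
    simp only [Function.comp, mem_Iic, e] at a1
    have c1 := hcont t ⟨ht.1.le, ht.2⟩
    have c2 := hcont _ hth
    have hvm := fp_v_meas β (V := V) (u := ψ t) c1.measurable
    have hmeas : Measurable (fun x => (ψ (t - h) x - ψ t x) / -h
        - (β⁻¹ * lap (ψ t) x + Fop V (ψ t) x)) := by
      have := c1.measurable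
      have := c2.measurable
      fun_prop
    obtain ⟨b1, b2⟩ := fp_L1 hp1 hmeas hε.le a1
    constructor
    · have : Integrable (fun x => (ψ (t - h) x - ψ t x) / -h) (μT m) :=
        fp_int (by fun_prop)
      refine (this.sub b1).congr (Eventually.of_forall fun x => ?_)
      simp
    · have : ∀ x, |ψ t x - ψ (t - h) x - h * (β⁻¹ * lap (ψ t) x + Fop V (ψ t) x)|
          = |(ψ (t - h) x - ψ t x) / -h - (β⁻¹ * lap (ψ t) x + Fop V (ψ t) x)| * h := by
        intro x
        rw [← abs_of_pos a3', ← abs_mul, abs_of_pos a3']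
        congr 1
        field_simp
        ring
      simp only [this]
      rw [integral_mul_const]
      exact mul_le_mul_of_nonneg_right b2 a3'.le
  refine ⟨hcont, fun t ht => (hs.regW2 t (sub1 t ht)).1,
    fun t ht => (hs.regW2 t (sub1 t ht)).2.2.1 (by norm_num),
    fun t ht => (hs.regW2 t (sub1 t ht)).2.2.2.1 le_rfl,
    fun t ht => (hs.regD t (sub1 t ht)).2, fun x => by rw [hs.init]; exact h1.2.1 x, ?_, ?_, ?_⟩
  · intro t ht
    exact (key t ht 1 one_pos).exists.choose_spec.1
  · intro t ht ε hε
    obtain ⟨δ, hδ, H⟩ := hs.contLp t (sub2 t ht) ε hε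
    refine ⟨δ, hδ, fun t' ht' htt => ?_⟩
    have := H t' (sub2 t' ht') htt
    simp only [WNorm, le_refl, if_true] at this
    exact (fp_L1 hp1 ((hcont t' ht').measurable.sub (hcont t ht).measurable) hε.le this.le).2
  · intro t ht ε hε
    exact (key t ht ε hε).mono fun _ h => h.2

lemma fp_alg {m : ℕ} {β : ℝ} (hβ : 0 < β) (u V : Spc m → ℝ) (x : Spc m) (s φ B : ℝ)
    (hB : gradDot V V x + φ ^ 2 ≤ B) :
    β⁻¹ / 2 * gradDot u u x - β * s ^ 2 * B ≤
      β⁻¹ * gradDot u u x + s * gradDot u V x - φ * s * pd (e1 m) u x := by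
  have hD : 0 < β⁻¹ := inv_pos.2 hβ
  have key : ∀ a c : ℝ, 0 ≤ β⁻¹ / 4 * (a * a) + s * (a * c) + β * s ^ 2 * (c * c) := by
    intro a c
    have : β⁻¹ / 4 * (a * a) + s * (a * c) + β * s ^ 2 * (c * c)
      = β⁻¹ * (a / 2 + β * s * c) ^ 2 := by
      field_simp
      ring
    rw [this]; positivity
  have h1 := key (pd (e1 m) u x) (pd (e1 m) V x)
  have h2 := key (pd (e1 m) u x) (-φ)
  have h3 : 0 ≤ ∑ i, (β⁻¹ / 4 * (pd (eC m i) u x * pd (eC m i) u x)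
      + s * (pd (eC m i) u x * pd (eC m i) V x)
      + β * s ^ 2 * (pd (eC m i) V x * pd (eC m i) V x)) :=
    Finset.sum_nonneg fun i _ => key _ _
  simp only [Finset.sum_add_distrib, ← Finset.mul_sum] at h3
  have h4 : 0 ≤ ∑ i, pd (eC m i) u x * pd (eC m i) u x :=
    Finset.sum_nonneg fun i _ => mul_self_nonneg _
  have h5 : β * s ^ 2 * (gradDot V V x + φ ^ 2) ≤ β * s ^ 2 * B :=
    mul_le_mul_of_nonneg_left hB (by positivity)
  have h6 := mul_nonneg hD.le h4
  simp only [gradDot] at *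
  nlinarith

lemma fp_min_sq (u : ℝ) : HasDerivAt (fun s : ℝ => (min s 0) ^ 2) (2 * min u 0) u := by
  rcases lt_trichotomy u 0 with h | h | h
  · rw [min_eq_left h.le]
    have : HasDerivAt (fun s : ℝ => s ^ 2) (2 * u) u := by simpa using hasDerivAt_pow 2 u
    refine this.congr_of_eventuallyEq ?_
    filter_upwards [Iio_mem_nhds h] with s hs
    rw [min_eq_left (le_of_lt hs)]
  · subst h
    rw [hasDerivAt_iff_isLittleO_nhds_zero]
    refine Asymptotics.isLittleO_iff.2 fun c hc => ?_
    filter_upwards [Metric.ball_mem_nhds (0:ℝ) hc] with h hh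
    have hh' : |h| < c := by simpa using hh
    simp only [zero_add, min_self, mul_zero, smul_zero, sub_zero, Real.norm_eq_abs]
    have : |min h 0| ≤ |h| := by
      rcases le_total h 0 with a | a
      · rw [min_eq_left a]
      · rw [min_eq_right a]; simp
    rw [zero_pow (by norm_num), sub_zero, abs_pow]
    nlinarith [abs_nonneg h, abs_nonneg (min h 0)]
  · rw [min_eq_right h.le, mul_zero]
    refine (hasDerivAt_const u (0:ℝ)).congr_of_eventuallyEq ?_
    filter_upwards [Ioi_mem_nhds h] with s hs
    rw [min_eq_right (le_of_lt hs)]; norm_num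

def fp_eta (ε u : ℝ) : ℝ := (min u 0) ^ 2 / ((min u 0) ^ 2 + ε ^ 2)
def fp_eta' (ε u : ℝ) : ℝ := 2 * min u 0 * ε ^ 2 / ((min u 0) ^ 2 + ε ^ 2) ^ 2

lemma fp_eta_deriv {ε : ℝ} (hε : 0 < ε) (u : ℝ) : HasDerivAt (fp_eta ε) (fp_eta' ε u) u := by
  have h := fp_min_sq u
  have hp : (min u 0) ^ 2 + ε ^ 2 ≠ 0 := by positivity
  refine (h.div (h.add_const (ε^2)) hp).congr_deriv ?_
  unfold fp_eta'
  congr 1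
  ring

lemma fp_eta_C1 {ε : ℝ} (hε : 0 < ε) : ContDiff ℝ 1 (fp_eta ε) := by
  rw [contDiff_one_iff_deriv]
  refine ⟨fun u => (fp_eta_deriv hε u).differentiableAt, ?_⟩
  have : deriv (fp_eta ε) = fp_eta' ε := funext fun u => (fp_eta_deriv hε u).deriv
  rw [this]
  unfold fp_eta'
  refine Continuous.div (by fun_prop) (by fun_prop) fun u => by positivity

lemma fp_eta'_np {ε : ℝ} (u : ℝ) : fp_eta' ε u ≤ 0 := by
  unfold fp_eta'
  apply div_nonpos_of_nonpos_of_nonneg _ (by positivity)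
  have : min u 0 ≤ 0 := min_le_right _ _
  nlinarith [sq_nonneg ε]

lemma fp_eta'_bd {ε : ℝ} (hε : 0 < ε) (u : ℝ) : -fp_eta' ε u * u ^ 2 ≤ ε := by
  unfold fp_eta'
  rcases le_total u 0 with h | h
  · rw [min_eq_left h, neg_mul, ← neg_le_neg_iff, neg_neg, div_mul_eq_mul_div, le_div_iff₀ (by positivity)]
    have : 0 ≤ ε * ((u^2 - ε^2)^2 + 2 * u^2 * (u + ε)^2) := by positivity
    nlinarith [pow_pos hε 3, sq_nonneg u, mul_nonneg (sq_nonneg u) (sq_nonneg u),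
      mul_nonneg (mul_nonneg hε.le (sq_nonneg u)) (sq_nonneg (u+ε)),
      mul_nonneg hε.le (mul_nonneg (sq_nonneg u) (sq_nonneg u)),
      mul_nonneg hε.le (sq_nonneg (u^2)), mul_nonneg hε.le (sq_nonneg (ε^2))]
  · rw [min_eq_right h]; simpa using hε.le

lemma fp_gradDot_comp {m : ℕ} {Φ Φ' : ℝ → ℝ} {u : Spc m → ℝ} (V : Spc m → ℝ) (x : Spc m)
    (hΦ : HasDerivAt Φ (Φ' (u x)) (u x)) (hu : Differentiable ℝ u) :
    gradDot (fun z => Φ (u z)) V x = Φ' (u x) * gradDot u V x := by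
  unfold gradDot
  simp only [fp_pd_comp _ x hΦ hu, mul_add, Finset.mul_sum, mul_assoc]

lemma fp_gradDot_cont {m : ℕ} {w g : Spc m → ℝ} (hw : ContDiff ℝ 1 w) (hg : ContDiff ℝ 1 g) :
    Continuous (fun x => gradDot w g x) := by
  unfold gradDot
  have := fp_pd_cont hw
  have := fp_pd_cont hg
  fun_prop

lemma fp_gradDot_per {m : ℕ} {w g : Spc m → ℝ} (hw : IsPeriodic w) (hg : IsPeriodic g) :
    IsPeriodic (fun x => gradDot w g x) := by
  intro x k j
  unfold gradDot
  simp only [fp_per_pd hw _ x k j, fp_per_pd hg _ x k j]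

/-- sign of the integral over the negativity set -/
lemma fp_neg_int {m : ℕ} {V u : Spc m → ℝ} {β : ℝ} (hβ : 0 < β) (hV : ContDiff ℝ 2 V)
    (hVp : IsPeriodic V)
    (hup : IsPeriodic u) (hud : Differentiable ℝ u) (hug : Differentiable ℝ (grd u))
    (hm : ∀ x1, 0 < marg u x1)
    (hi : Integrable (fun x => β⁻¹ * lap u x + Fop V u x) (μT m)) :
    0 ≤ ∫ x, (if u x < 0 then 1 else 0) * (β⁻¹ * lap u x + Fop V u x) ∂(μT m) := by
  have hu := fp_C1 hud hug
  have hV1 : ContDiff ℝ 1 V := hV.of_le (by norm_num)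
  have hφ := fp_phi_diff hV hu hm
  have hφz : Continuous (fun z : Spc m => phiF V u z.1) := hφ.continuous.comp continuous_fst
  have hφp : IsPeriodic (fun z : Spc m => phiF V u z.1) := fun x k j => fp_phi_per hVp hup _ _
  obtain ⟨B, hB0, hB⟩ := fp_per_bdd (f := fun x => gradDot V V x + phiF V u x.1 ^ 2)
    (fp_per_add (fp_gradDot_per hVp hVp) (fp_per_comp hφp (fun s => s ^ 2)))
    ((fp_gradDot_cont hV1 hV1).add (hφz.pow 2))
  have step : ∀ ε > 0, -(ε * (β * B)) ≤
      ∫ x, fp_eta ε (u x) * (β⁻¹ * lap u x + Fop V u x) ∂(μT m) := by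
    intro ε hε
    obtain ⟨i1, i2, i3⟩ := fp_ibp (w := fun x => fp_eta ε (u x)) (β := β) hV hVp hup hud hug hm
      ((fp_eta_C1 hε).comp hu) (fp_per_comp hup _) hi
    rw [i3, neg_le_neg_iff]
    have : ∫ x, ε * (β * B) ∂(μT m) = ε * (β * B) := by simp
    rw [← this]
    refine integral_mono i2 (integrable_const _) fun x => ?_
    have hd := fp_eta_deriv hε (u x)
    simp only [fp_gradDot_comp _ x hd hud, fp_pd_comp _ x hd hud]
    have a1 := fp_alg hβ u V x (u x) (phiF V u x.1) B ((le_abs_self _).trans (hB x))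
    have a2 : 0 ≤ β⁻¹ / 2 * gradDot u u x := by
      have : 0 ≤ gradDot u u x :=
        add_nonneg (mul_self_nonneg _) (Finset.sum_nonneg fun i _ => mul_self_nonneg _)
      positivity
    have a3 := fp_eta'_np (ε := ε) (u x)
    have a4 := fp_eta'_bd hε (u x)
    have a5 := mul_le_mul_of_nonneg_right a4 (mul_nonneg hβ.le hB0)
    have a6 : -(β * u x ^ 2 * B) ≤ β⁻¹ * gradDot u u x + u x * gradDot u V x
      - phiF V u x.1 * u x * pd (e1 m) u x := by linarith
    have a7 := mul_le_mul_of_nonneg_left a6 (neg_nonneg.2 a3)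
    nlinarith
  have hlim : Tendsto (fun k : ℕ => ∫ x, fp_eta (1 / ((k:ℝ) + 1)) (u x)
      * (β⁻¹ * lap u x + Fop V u x) ∂(μT m)) atTop
      (nhds (∫ x, (if u x < 0 then 1 else 0) * (β⁻¹ * lap u x + Fop V u x) ∂(μT m))) := by
    refine tendsto_integral_of_dominated_convergence
      (fun x => |β⁻¹ * lap u x + Fop V u x|) ?_ hi.abs ?_ ?_
    · intro k
      have h1 : Continuous (fun x => fp_eta (1 / ((k:ℝ) + 1)) (u x)) :=
        (fp_eta_C1 (by positivity)).continuous.comp hu.continuous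
      exact h1.aestronglyMeasurable.mul hi.aestronglyMeasurable
    · intro k
      refine Eventually.of_forall fun x => ?_
      rw [norm_mul, Real.norm_eq_abs, Real.norm_eq_abs]
      refine mul_le_of_le_one_left (abs_nonneg _) ?_
      unfold fp_eta
      rw [abs_of_nonneg (by positivity)]
      refine div_le_one_of_le₀ ?_ (by positivity)
      have : (0:ℝ) ≤ (1 / ((k:ℝ) + 1)) ^ 2 := by positivity
      linarith
    · refine Eventually.of_forall fun x => ?_
      refine Tendsto.mul_const _ ?_
      have h0 : Tendsto (fun k : ℕ => 1 / ((k:ℝ) + 1)) atTop (nhds 0) :=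
        tendsto_one_div_add_atTop_nhds_zero_nat
      unfold fp_eta
      by_cases hx : u x < 0
      · rw [if_pos hx, min_eq_left hx.le]
        have : Tendsto (fun k : ℕ => u x ^ 2 / (u x ^ 2 + (1 / ((k:ℝ) + 1)) ^ 2)) atTop
          (nhds (u x ^ 2 / (u x ^ 2 + 0 ^ 2))) := by
          refine Tendsto.div tendsto_const_nhds (tendsto_const_nhds.add (h0.pow 2)) ?_
          have := pow_pos (neg_pos.2 hx) 2
          nlinarith
        convert this using 2
        have : u x ^ 2 ≠ 0 := pow_ne_zero _ hx.ne
        field_simp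
        simp
      · rw [if_neg hx, min_eq_right (not_lt.1 hx)]
        simp
  have hlim2 : Tendsto (fun k : ℕ => -(1 / ((k:ℝ) + 1) * (β * B))) atTop (nhds 0) := by
    have := ((tendsto_one_div_add_atTop_nhds_zero_nat (𝕜 := ℝ)).mul_const (β * B)).neg
    simpa using this
  exact le_of_tendsto_of_tendsto' hlim2 hlim fun k => step _ (by positivity)

lemma fp_contY1 {m : ℕ} {V : Spc m → ℝ} {β T : ℝ} {ψ : ℝ → Spc m → ℝ} (S : fp_Sol V β T ψ)
    {Φ : ℝ → ℝ} (hΦ : Continuous Φ) (hL : ∀ a b, |Φ a - Φ b| ≤ |a - b|) :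
    ContinuousOn (fun τ => ∫ x, Φ (ψ τ x) ∂(μT m)) (Icc 0 T) := by
  rw [Metric.continuousOn_iff]
  intro t ht ε hε
  obtain ⟨δ, hδ, H⟩ := S.contL1 t ht (ε/2) (by positivity)
  refine ⟨δ, hδ, fun t' ht' hd => ?_⟩
  rw [Real.dist_eq] at hd ⊢
  have c1 := S.cont t ht
  have c2 := S.cont t' ht'
  have i1 : Integrable (fun x => Φ (ψ t x)) (μT m) := fp_int (by fun_prop)
  have i2 : Integrable (fun x => Φ (ψ t' x)) (μT m) := fp_int (by fun_prop)
  have i3 : Integrable (fun x => |ψ t' x - ψ t x|) (μT m) := fp_int (by fun_prop)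
  rw [← integral_sub i2 i1]
  refine lt_of_le_of_lt (b := ε/2) ?_ (by linarith)
  refine le_trans ?_ (H t' ht' hd)
  rw [← Real.norm_eq_abs]
  exact norm_integral_le_of_norm_le i3 (Eventually.of_forall fun x => hL _ _)

lemma fp_nonneg {m : ℕ} {V : Spc m → ℝ} {β T : ℝ} {ψ : ℝ → Spc m → ℝ} (hβ : 0 < β)
    (hV : ContDiff ℝ 2 V) (hVp : IsPeriodic V) (S : fp_Sol V β T ψ) :
    ∀ t ∈ Icc 0 T, ∀ x, 0 ≤ ψ t x := by
  intro t ht x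
  rcases ht.1.eq_or_lt with h0 | h0
  · rw [← h0]; exact S.init x
  have hsub : Icc 0 t ⊆ Icc 0 T := Icc_subset_Icc le_rfl ht.2
  have hmin : ∀ a b : ℝ, |min a 0 - min b 0| ≤ |a - b| := by
    intro a b
    have := abs_min_sub_min_le_max a 0 b 0
    simpa using this
  have hc := (fp_contY1 S (Φ := fun a => min a 0) (by fun_prop) hmin).mono hsub
  have hmono := fp_mono h0.le hc ?_
  · have z : ∫ x, min (ψ 0 x) 0 ∂(μT m) = 0 := by
      simp [min_eq_right (S.init _)]
    rw [z] at hmono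
    have c1 := S.cont t ht
    have hz : ∀ᵐ x ∂(μT m), min (ψ t x) 0 = 0 := by
      have i1 : Integrable (fun x => - min (ψ t x) 0) (μT m) := fp_int (by fun_prop)
      have h1 : ∫ x, - min (ψ t x) 0 ∂(μT m) = 0 := by
        apply le_antisymm
        · rw [integral_neg]; linarith
        · exact integral_nonneg fun x => neg_nonneg.2 (min_le_right _ _)
      rw [integral_eq_zero_iff_of_nonneg (fun x => neg_nonneg.2 (min_le_right _ _)) i1] at h1
      filter_upwards [h1] with x hx
      simpa using hx
    have := fp_ico_mem (f := fun x => min (ψ t x) 0)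
      (fp_per_comp (S.per t ⟨h0, ht.2⟩) (fun a => min a 0)) (by fun_prop) hz x
    exact min_eq_right_iff.1 this
  · intro τ hτ ε hε
    have hτ' : τ ∈ Ioc 0 T := ⟨hτ.1, hτ.2.trans ht.2⟩
    have hN := fp_neg_int hβ hV hVp (S.per τ hτ') (S.diff τ hτ') (S.diff2 τ hτ') (S.marg τ hτ')
      (S.intv τ hτ')
    have hlt : ∀ᶠ h in nhdsWithin (0:ℝ) (Ioi 0), h < τ :=
      nhdsWithin_le_nhds (Iio_mem_nhds hτ.1)
    filter_upwards [S.diffL1 τ hτ' ε hε, hlt, self_mem_nhdsWithin] with h a1 a2 a3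
    have a3' : 0 < h := a3
    have c1 := S.cont τ ⟨hτ'.1.le, hτ'.2⟩
    have c2 := S.cont (τ - h) ⟨by linarith, by linarith [hτ'.2]⟩
    have i1 : Integrable (fun x => min (ψ τ x) 0) (μT m) := fp_int (by fun_prop)
    have i2 : Integrable (fun x => min (ψ (τ - h) x) 0) (μT m) := fp_int (by fun_prop)
    have iv := S.intv τ hτ'
    set v := fun x => β⁻¹ * lap (ψ τ) x + Fop V (ψ τ) x with hv
    have i3 : Integrable (fun x => |ψ τ x - ψ (τ - h) x - h * v x|) (μT m) :=
      (Integrable.sub (fp_int (by fun_prop)) (iv.const_mul h)).abs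
    have i4 : Integrable (fun x => (if ψ τ x < 0 then (1:ℝ) else 0) * v x) (μT m) := by
      refine iv.bdd_mul (c := 1) ?_ ?_
      · exact (Measurable.ite (measurableSet_lt c1.measurable measurable_const)
          measurable_const measurable_const).aestronglyMeasurable
      · refine Eventually.of_forall fun x => ?_
        split_ifs <;> simp
    rw [← integral_sub i1 i2]
    have hle : ∫ x, (h * ((if ψ τ x < 0 then (1:ℝ) else 0) * v x)
        - |ψ τ x - ψ (τ - h) x - h * v x|) ∂(μT m)
        ≤ ∫ x, (min (ψ τ x) 0 - min (ψ (τ - h) x) 0) ∂(μT m) := by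
      refine integral_mono ((i4.const_mul h).sub i3) (i1.sub i2) fun x => ?_
      have k1 := neg_abs_le (ψ τ x - ψ (τ - h) x - h * v x)
      have k2 := abs_nonneg (ψ τ x - ψ (τ - h) x - h * v x)
      simp only
      split_ifs with hx
      · rw [min_eq_left hx.le]
        have := min_le_left (ψ (τ - h) x) 0
        linarith
      · rw [min_eq_right (not_lt.1 hx)]
        have := min_le_right (ψ (τ - h) x) 0
        linarith
    rw [integral_sub (i4.const_mul h) i3, integral_const_mul] at hle
    have := mul_nonneg a3'.le hN
    linarith

lemma fp_unif {m : ℕ} {a b : ℝ} {G Gt : ℝ → Spc m → ℝ}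
    (hG : ∀ τ ∈ Icc a b, ∀ x, HasDerivAt (fun s => G s x) (Gt τ x) τ)
    (hGt : ContinuousOn (fun z : ℝ × Spc m => Gt z.1 z.2) (Icc a b ×ˢ Icc 0 1))
    {τ : ℝ} (hτ : τ ∈ Ioc a b) {ε : ℝ} (hε : 0 < ε) :
    ∀ᶠ h in nhdsWithin (0:ℝ) (Ioi 0), ∀ x ∈ cube m,
      |G τ x - G (τ - h) x - h * Gt τ x| ≤ ε * h := by
  have hU := (isCompact_Icc.prod isCompact_Icc).uniformContinuousOn_of_continuous hGt
  rw [Metric.uniformContinuousOn_iff] at hU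
  obtain ⟨δ, hδ, H⟩ := hU ε hε
  have h1 : ∀ᶠ h in nhdsWithin (0:ℝ) (Ioi 0), h < δ := nhdsWithin_le_nhds (Iio_mem_nhds hδ)
  have h2 : ∀ᶠ h in nhdsWithin (0:ℝ) (Ioi 0), h < τ - a :=
    nhdsWithin_le_nhds (Iio_mem_nhds (by linarith [hτ.1]))
  filter_upwards [h1, h2, self_mem_nhdsWithin] with h a1 a2 a3 x hx
  have a3' : 0 < h := a3
  have hsub : Icc (τ - h) τ ⊆ Icc a b := Icc_subset_Icc (by linarith) hτ.2
  have := (convex_Icc (τ - h) τ).norm_image_sub_le_of_norm_hasDerivWithin_le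
    (f := fun s => G s x - s * Gt τ x) (f' := fun s => Gt s x - Gt τ x) (C := ε)
    (x := τ - h) (y := τ) ?_ ?_ ⟨le_rfl, by linarith⟩ ⟨by linarith, le_rfl⟩
  · simp only [Real.norm_eq_abs] at this
    rw [show τ - (τ - h) = h by ring, abs_of_pos a3'] at this
    convert this using 2
    ring
  · intro s hs
    have e := (hG s (hsub hs) x).sub ((hasDerivAt_id s).mul_const (Gt τ x))
    rw [one_mul] at e
    exact e.hasDerivWithinAt
  · intro s hs
    have := H (s, x) ⟨hsub hs, fp_cube_sub hx⟩ (τ, x) ⟨⟨hτ.1.le, hτ.2⟩, fp_cube_sub hx⟩ ?_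
    · rw [Real.dist_eq] at this
      exact this.le
    · rw [Prod.dist_eq, dist_self, max_eq_left dist_nonneg, Real.dist_eq, abs_lt]
      exact ⟨by linarith [hs.1], by linarith [hs.2]⟩

structure fp_Phi (Φ Φ' : ℝ → ℝ) (K L : ℝ) : Prop where
  cont : ContinuousOn Φ (Ici 0)
  cont' : ContinuousOn Φ' (Ici 0)
  K0 : 0 ≤ K
  L0 : 0 ≤ L
  bd : ∀ a, 0 ≤ a → |Φ a| ≤ K
  bd' : ∀ a, 0 ≤ a → |Φ' a| ≤ L
  lip : ∀ a b, 0 ≤ a → 0 ≤ b → |Φ a - Φ b| ≤ L * |a - b|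
  sg : ∀ a b, 0 ≤ a → 0 ≤ b → Φ' a * (a - b) ≤ Φ a - Φ b

lemma fp_ae {m : ℕ} {P : Spc m → Prop} (h : ∀ x ∈ cube m, P x) : ∀ᵐ x ∂(μT m), P x :=
  (ae_restrict_iff' (fp_cube_meas m)).2 (Eventually.of_forall h)

lemma fp_mono_cube {m : ℕ} {f g : Spc m → ℝ} (hf : Integrable f (μT m)) (hg : Integrable g (μT m))
    (h : ∀ x ∈ cube m, f x ≤ g x) : ∫ x, f x ∂(μT m) ≤ ∫ x, g x ∂(μT m) :=
  integral_mono_ae hf hg (fp_ae h)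

/-- bookkeeping: integrable with given integral -/
def fp_I {m : ℕ} (f : Spc m → ℝ) (c : ℝ) : Prop := Integrable f (μT m) ∧ ∫ x, f x ∂(μT m) = c

lemma fp_I.of {m : ℕ} {f : Spc m → ℝ} (h : Integrable f (μT m)) : fp_I f (∫ x, f x ∂(μT m)) := ⟨h, rfl⟩
lemma fp_I.ofc {m : ℕ} {f : Spc m → ℝ} (h : Continuous f) : fp_I f (∫ x, f x ∂(μT m)) :=
  ⟨fp_int h, rfl⟩
lemma fp_I.add {m : ℕ} {f g : Spc m → ℝ} {c d : ℝ} (h : fp_I f c) (h' : fp_I g d) :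
    fp_I (fun x => f x + g x) (c + d) :=
  ⟨h.1.add h'.1, by rw [integral_add h.1 h'.1, h.2, h'.2]⟩
lemma fp_I.sub {m : ℕ} {f g : Spc m → ℝ} {c d : ℝ} (h : fp_I f c) (h' : fp_I g d) :
    fp_I (fun x => f x - g x) (c - d) :=
  ⟨h.1.sub h'.1, by rw [integral_sub h.1 h'.1, h.2, h'.2]⟩
lemma fp_I.cm {m : ℕ} {f : Spc m → ℝ} {c : ℝ} (h : fp_I f c) (k : ℝ) :
    fp_I (fun x => k * f x) (k * c) :=
  ⟨h.1.const_mul k, by rw [integral_const_mul, h.2]⟩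
lemma fp_I.const (m : ℕ) (k : ℝ) : fp_I (fun _ : Spc m => k) k :=
  ⟨integrable_const k, by simp⟩
lemma fp_I.mono {m : ℕ} {f g : Spc m → ℝ} {c d : ℝ} (h : fp_I f c) (h' : fp_I g d)
    (hh : ∀ x ∈ cube m, f x ≤ g x) : c ≤ d := by
  rw [← h.2, ← h'.2]
  exact fp_mono_cube h.1 h'.1 hh
lemma fp_I.congr {m : ℕ} {f g : Spc m → ℝ} {c : ℝ} (h : fp_I f c) (hh : ∀ x, g x = f x) :
    fp_I g c := by
  have : g = f := funext hh
  rwa [this]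

structure fp_Ker {m : ℕ} (a b : ℝ) (G Gt : ℝ → Spc m → ℝ) : Prop where
  der : ∀ τ ∈ Icc a b, ∀ x, HasDerivAt (fun s => G s x) (Gt τ x) τ
  jc : ContinuousOn (fun z : ℝ × Spc m => G z.1 z.2) (Icc a b ×ˢ Icc 0 1)
  jct : ContinuousOn (fun z : ℝ × Spc m => Gt z.1 z.2) (Icc a b ×ˢ Icc 0 1)
  c : ∀ τ ∈ Icc a b, Continuous (G τ)
  ct : ∀ τ ∈ Icc a b, Continuous (Gt τ)
  nn : ∀ τ ∈ Icc a b, ∀ x, 0 ≤ G τ x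

lemma fp_cpt_bd {m : ℕ} {a b : ℝ} {G : ℝ → Spc m → ℝ}
    (h : ContinuousOn (fun z : ℝ × Spc m => G z.1 z.2) (Icc a b ×ˢ Icc 0 1)) :
    ∃ C, 0 ≤ C ∧ ∀ τ ∈ Icc a b, ∀ x ∈ cube m, |G τ x| ≤ C := by
  obtain ⟨C, hC⟩ := (isCompact_Icc.prod isCompact_Icc).exists_bound_of_continuousOn h
  exact ⟨max C 0, le_max_right _ _, fun τ hτ x hx =>
    (hC (τ, x) ⟨hτ, fp_cube_sub hx⟩).trans (le_max_left _ _)⟩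

lemma fp_Y_cont {m : ℕ} {V : Spc m → ℝ} {β T : ℝ} {ψ : ℝ → Spc m → ℝ} (S : fp_Sol V β T ψ)
    (hn : ∀ t ∈ Icc 0 T, ∀ x, 0 ≤ ψ t x)
    {Φ Φ' : ℝ → ℝ} {K L : ℝ} (P : fp_Phi Φ Φ' K L) {a b : ℝ} (ha : 0 ≤ a) (hb : b ≤ T)
    {G Gt : ℝ → Spc m → ℝ} (R : fp_Ker a b G Gt) :
    ContinuousOn (fun τ => ∫ x, G τ x * Φ (ψ τ x) ∂(μT m)) (Icc a b) := by
  obtain ⟨C, hC0, hC⟩ := fp_cpt_bd R.jc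
  have hsub : Icc a b ⊆ Icc 0 T := Icc_subset_Icc ha hb
  rw [Metric.continuousOn_iff]
  intro t ht ε hε
  have hU := (isCompact_Icc.prod isCompact_Icc).uniformContinuousOn_of_continuous R.jc
  rw [Metric.uniformContinuousOn_iff] at hU
  have hK := P.K0
  have hL := P.L0
  obtain ⟨δ1, hδ1, H1⟩ := hU (ε / (4 * (K + 1))) (by positivity)
  obtain ⟨δ2, hδ2, H2⟩ := S.contL1 t (hsub ht) (ε / (4 * (C * L + 1))) (by positivity)
  refine ⟨min δ1 δ2, lt_min hδ1 hδ2, fun t' ht' hd => ?_⟩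
  rw [Real.dist_eq] at hd ⊢
  have c1 := S.cont t (hsub ht)
  have c2 := S.cont t' (hsub ht')
  have d1 : Continuous (fun x => Φ (ψ t x)) := P.cont.comp_continuous c1 (hn t (hsub ht))
  have d2 : Continuous (fun x => Φ (ψ t' x)) := P.cont.comp_continuous c2 (hn t' (hsub ht'))
  have e1 := R.c t ht
  have e2 := R.c t' ht'
  have i1 : Integrable (fun x => G t x * Φ (ψ t x)) (μT m) := fp_int (e1.mul d1)
  have i2 : Integrable (fun x => G t' x * Φ (ψ t' x)) (μT m) := fp_int (e2.mul d2)
  have i3 : Integrable (fun x => |ψ t' x - ψ t x|) (μT m) := fp_int (by fun_prop)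
  rw [← integral_sub i2 i1]
  have key : |∫ x, (G t' x * Φ (ψ t' x) - G t x * Φ (ψ t x)) ∂(μT m)|
      ≤ ∫ x, (ε / (4 * (K + 1)) * K + C * L * |ψ t' x - ψ t x|) ∂(μT m) := by
    rw [← Real.norm_eq_abs]
    refine norm_integral_le_of_norm_le ((integrable_const _).add (i3.const_mul _)) (fp_ae ?_)
    intro x hx
    have g1 := H1 (t', x) ⟨ht', fp_cube_sub hx⟩ (t, x) ⟨ht, fp_cube_sub hx⟩ (by
      rw [Prod.dist_eq, dist_self, max_eq_left dist_nonneg, Real.dist_eq]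
      exact hd.trans_le (min_le_left _ _))
    rw [Real.dist_eq] at g1
    simp only at g1
    have g2 := hC t ht x hx
    have g3 := P.bd _ (hn t' (hsub ht') x)
    have g4 := P.lip _ _ (hn t' (hsub ht') x) (hn t (hsub ht) x)
    rw [Real.norm_eq_abs, show G t' x * Φ (ψ t' x) - G t x * Φ (ψ t x)
      = (G t' x - G t x) * Φ (ψ t' x) + G t x * (Φ (ψ t' x) - Φ (ψ t x)) by ring]
    refine (abs_add_le _ _).trans (add_le_add ?_ ?_)
    · rw [abs_mul]
      exact mul_le_mul g1.le g3 (abs_nonneg _) (by positivity)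
    · rw [abs_mul, mul_assoc]
      exact mul_le_mul g2 g4 (abs_nonneg _) hC0
  refine lt_of_le_of_lt key ?_
  rw [((fp_I.const m (ε / (4 * (K + 1)) * K)).add ((fp_I.of i3).cm (C * L))).2]
  have q1 := H2 t' (hsub ht') (hd.trans_le (min_le_right _ _))
  have q2 : ε / (4 * (K + 1)) * K ≤ ε / 4 := by
    rw [div_mul_eq_mul_div, div_le_div_iff₀ (by positivity) (by positivity)]
    nlinarith
  have q3 : C * L * (ε / (4 * (C * L + 1))) ≤ ε / 4 := by
    rw [mul_div_assoc', div_le_div_iff₀ (by positivity) (by positivity)]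
    nlinarith
  have q4 := mul_le_mul_of_nonneg_left q1 (mul_nonneg hC0 hL)
  linarith

lemma fp_Y_dini {m : ℕ} {V : Spc m → ℝ} {β T : ℝ} {ψ : ℝ → Spc m → ℝ} (S : fp_Sol V β T ψ)
    (hn : ∀ t ∈ Icc 0 T, ∀ x, 0 ≤ ψ t x)
    {Φ Φ' : ℝ → ℝ} {K L : ℝ} (P : fp_Phi Φ Φ' K L) {a b : ℝ} (ha : 0 ≤ a) (hb : b ≤ T)
    {G Gt : ℝ → Spc m → ℝ} (R : fp_Ker a b G Gt) {τ : ℝ} (hτ : τ ∈ Ioc a b) :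
    fp_LD (fun τ => ∫ x, G τ x * Φ (ψ τ x) ∂(μT m)) τ
      (∫ x, Gt τ x * Φ (ψ τ x) ∂(μT m)
        + ∫ x, G τ x * Φ' (ψ τ x) * (β⁻¹ * lap (ψ τ) x + Fop V (ψ τ) x) ∂(μT m)) := by
  obtain ⟨C, hC0, hC⟩ := fp_cpt_bd R.jc
  obtain ⟨C1, hC10, hC1⟩ := fp_cpt_bd R.jct
  have hsub : Icc a b ⊆ Icc 0 T := Icc_subset_Icc ha hb
  have hτi : τ ∈ Icc a b := ⟨hτ.1.le, hτ.2⟩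
  have hτ' : τ ∈ Ioc 0 T := ⟨ha.trans_lt hτ.1, hτ.2.trans hb⟩
  have hK := P.K0
  have hL := P.L0
  intro ε hε
  obtain ⟨ε1, hε1, q1, hε11⟩ : ∃ ε1 > 0, ε1 * K ≤ ε / 3 ∧ ε1 ≤ 1 := by
    refine ⟨min 1 (ε / (3 * (K + 1))), by positivity, ?_, min_le_left _ _⟩
    refine (mul_le_mul_of_nonneg_right (min_le_right _ _) hK).trans ?_
    rw [div_mul_eq_mul_div, div_le_div_iff₀ (by positivity) (by positivity)]
    nlinarith
  obtain ⟨ε2, hε2, q2⟩ : ∃ ε2 > 0, C * L * ε2 ≤ ε / 3 := by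
    refine ⟨ε / (3 * (C * L + 1)), by positivity, ?_⟩
    rw [mul_div_assoc', div_le_div_iff₀ (by positivity) (by positivity)]
    nlinarith
  obtain ⟨ε3, hε3, q3⟩ : ∃ ε3 > 0, (C1 + 1) * L * ε3 ≤ ε / 3 := by
    have : 0 ≤ (C1 + 1) * L := by positivity
    refine ⟨ε / (3 * ((C1 + 1) * L + 1)), by positivity, ?_⟩
    rw [mul_div_assoc', div_le_div_iff₀ (by positivity) (by positivity)]
    nlinarith
  obtain ⟨δ, hδ, H3⟩ := S.contL1 τ (hsub hτi) ε3 hε3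
  have h1 : ∀ᶠ h in nhdsWithin (0:ℝ) (Ioi 0), h < δ := nhdsWithin_le_nhds (Iio_mem_nhds hδ)
  have h2 : ∀ᶠ h in nhdsWithin (0:ℝ) (Ioi 0), h < τ - a :=
    nhdsWithin_le_nhds (Iio_mem_nhds (by linarith [hτ.1]))
  filter_upwards [h1, h2, self_mem_nhdsWithin, fp_unif R.der R.jct hτ hε1,
    S.diffL1 τ hτ' ε2 hε2] with h a1 a2 a3 a4 a5
  have a3' : 0 < h := a3
  have hs : τ - h ∈ Icc a b := ⟨by linarith, by linarith [hτ.2]⟩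
  have iv := S.intv τ hτ'
  set v := fun x => β⁻¹ * lap (ψ τ) x + Fop V (ψ τ) x with hv
  have c1 := S.cont τ (hsub hτi)
  have c2 := S.cont _ (hsub hs)
  have n1 := hn τ (hsub hτi)
  have n2 := hn _ (hsub hs)
  have d1 : Continuous (fun x => Φ (ψ τ x)) := P.cont.comp_continuous c1 n1
  have d1' : Continuous (fun x => Φ' (ψ τ x)) := P.cont'.comp_continuous c1 n1
  have d2 : Continuous (fun x => Φ (ψ (τ - h) x)) := P.cont.comp_continuous c2 n2
  have g1 := R.c τ hτi
  have g2 := R.c _ hs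
  have g3 := R.ct τ hτi
  have i1 : Integrable (fun x => G τ x * Φ (ψ τ x)) (μT m) := fp_int (g1.mul d1)
  have i2 : Integrable (fun x => G (τ - h) x * Φ (ψ (τ - h) x)) (μT m) := fp_int (g2.mul d2)
  have i3 : Integrable (fun x => |ψ τ x - ψ (τ - h) x - h * v x|) (μT m) :=
      (Integrable.sub (fp_int (by fun_prop)) (iv.const_mul h)).abs
  have i4 : Integrable (fun x => Gt τ x * Φ (ψ τ x)) (μT m) := fp_int (g3.mul d1)
  have i5 : Integrable (fun x => G τ x * Φ' (ψ τ x) * v x) (μT m) := by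
    refine iv.bdd_mul (c := C * L) (g1.mul d1').aestronglyMeasurable (fp_ae fun x hx => ?_)
    rw [norm_mul]
    exact mul_le_mul (hC τ hτi x hx) (P.bd' _ (n1 x)) (norm_nonneg _) hC0
  have i6 : Integrable (fun x => |ψ (τ - h) x - ψ τ x|) (μT m) := fp_int (by fun_prop)
  have b3 := H3 (τ - h) (hsub hs) (by rw [show τ - h - τ = -h by ring, abs_neg, abs_of_pos a3']; exact a1)
  have key := fp_I.mono ((((fp_I.of i4).cm h).add ((fp_I.of i5).cm h)).sub
    (((fp_I.const m (ε1 * h * K)).add ((fp_I.of i3).cm (C * L))).add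
      ((fp_I.of i6).cm ((C1 + 1) * h * L)))) ((fp_I.of i1).sub (fp_I.of i2)) ?_
  rotate_left
  · intro x hx
    have k1 := a4 x hx
    have k2 := hC τ hτi x hx
    have k3 := hC1 τ hτi x hx
    have k4 := P.bd _ (n1 x)
    have k4' := P.bd' _ (n1 x)
    have k5 := P.lip _ _ (n2 x) (n1 x)
    have k6 := P.sg _ _ (n1 x) (n2 x)
    have k7 := R.nn τ hτi x
    have k8 : |G τ x - G (τ - h) x| ≤ (C1 + 1) * h := by
      have := abs_add_le (G τ x - G (τ - h) x - h * Gt τ x) (h * Gt τ x)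
      rw [sub_add_cancel, abs_mul h, abs_of_pos a3'] at this
      nlinarith
    set r := ψ τ x - ψ (τ - h) x - h * v x with hr
    have s1 : G τ x * (Φ' (ψ τ x) * (ψ τ x - ψ (τ - h) x)) ≤
      G τ x * (Φ (ψ τ x) - Φ (ψ (τ - h) x)) := mul_le_mul_of_nonneg_left k6 k7
    have s2 : |G τ x * Φ' (ψ τ x) * r| ≤ C * L * |r| := by
      rw [abs_mul, abs_mul]
      gcongr
    have s3 : |(G τ x - G (τ - h) x - h * Gt τ x) * Φ (ψ τ x)| ≤ ε1 * h * K := by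
      rw [abs_mul]
      gcongr
    have s4 : |(G τ x - G (τ - h) x) * (Φ (ψ (τ - h) x) - Φ (ψ τ x))|
      ≤ (C1 + 1) * h * L * |ψ (τ - h) x - ψ τ x| := by
      rw [abs_mul, mul_assoc _ L]
      gcongr
    have t2 := (abs_le.1 s2).1
    have t3 := (abs_le.1 s3).1
    have t4 := (abs_le.1 s4).1
    have e : ψ τ x - ψ (τ - h) x = r + h * v x := by rw [hr]; ring
    rw [e] at s1
    nlinarith
  have m1 := mul_le_mul_of_nonneg_right q1 a3'.le
  have m2 := mul_le_mul_of_nonneg_left a5 (mul_nonneg hC0 hL)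
  have m2' := mul_le_mul_of_nonneg_right q2 a3'.le
  have m3 := mul_le_mul_of_nonneg_left b3 (show 0 ≤ (C1 + 1) * h * L by positivity)
  have m3' := mul_le_mul_of_nonneg_right q3 a3'.le
  nlinarith

def fp_L (δ u : ℝ) : ℝ := Real.log (u + δ) - Real.log (u + δ + 1)
def fp_L' (δ u : ℝ) : ℝ := (u + δ)⁻¹ - (u + δ + 1)⁻¹
def fp_L'' (δ u : ℝ) : ℝ := -((u + δ) ^ 2)⁻¹ + ((u + δ + 1) ^ 2)⁻¹

lemma fp_L_d {δ u : ℝ} (hδ : 0 < δ) (hu : 0 ≤ u) : HasDerivAt (fp_L δ) (fp_L' δ u) u := by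
  have h1 : u + δ ≠ 0 := by positivity
  have h2 : u + δ + 1 ≠ 0 := by positivity
  have a := ((hasDerivAt_id u).add_const δ)
  have := (a.log h1).sub ((a.add_const 1).log h2)
  refine this.congr_deriv ?_
  unfold fp_L'
  simp [one_div]

lemma fp_L'_d {δ u : ℝ} (hδ : 0 < δ) (hu : 0 ≤ u) : HasDerivAt (fp_L' δ) (fp_L'' δ u) u := by
  have h1 : u + δ ≠ 0 := by positivity
  have h2 : u + δ + 1 ≠ 0 := by positivity
  have a := ((hasDerivAt_id u).add_const δ)
  have := (a.inv h1).sub ((a.add_const 1).inv h2)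
  refine this.congr_deriv ?_
  unfold fp_L''
  simp only [id]
  field_simp
  ring

lemma fp_L'_pos {δ u : ℝ} (hδ : 0 < δ) (hu : 0 ≤ u) : 0 ≤ fp_L' δ u := by
  unfold fp_L'
  rw [sub_nonneg]
  exact inv_anti₀ (by positivity) (by linarith)

lemma fp_L'_le {δ u : ℝ} (hδ : 0 < δ) (hu : 0 ≤ u) : fp_L' δ u ≤ (u + δ)⁻¹ := by
  unfold fp_L'
  have : 0 ≤ (u + δ + 1)⁻¹ := by positivity
  linarith

lemma fp_L'_mul {δ u : ℝ} (hδ : 0 < δ) (hu : 0 ≤ u) : fp_L' δ u * u ≤ 1 := by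
  refine (mul_le_mul_of_nonneg_right (fp_L'_le hδ hu) hu).trans ?_
  rw [inv_mul_le_one₀ (by positivity)]
  linarith

lemma fp_L''_ge {δ u : ℝ} (hδ : 0 < δ) (hu : 0 ≤ u) : fp_L' δ u ^ 2 ≤ - fp_L'' δ u := by
  have h1 : 0 ≤ (u + δ + 1)⁻¹ := by positivity
  have h2 : (u + δ + 1)⁻¹ ≤ (u + δ)⁻¹ := inv_anti₀ (by positivity) (by linarith)
  unfold fp_L' fp_L''
  rw [← inv_pow, ← inv_pow]
  nlinarith

lemma fp_L''_mul {δ u : ℝ} (hδ : 0 < δ) (hu : 0 ≤ u) : - fp_L'' δ u * u ^ 2 ≤ 1 := by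
  have : - fp_L'' δ u ≤ ((u + δ) ^ 2)⁻¹ := by
    unfold fp_L''
    have : 0 ≤ ((u + δ + 1) ^ 2)⁻¹ := by positivity
    linarith
  refine (mul_le_mul_of_nonneg_right this (sq_nonneg u)).trans ?_
  rw [inv_mul_le_one₀ (by positivity)]
  nlinarith

lemma fp_L_np {δ u : ℝ} (hδ : 0 < δ) (hu : 0 ≤ u) : fp_L δ u ≤ 0 := by
  unfold fp_L
  rw [sub_nonpos]
  exact Real.log_le_log (by positivity) (by linarith)

lemma fp_L_anti {δ u v : ℝ} (hδ : 0 < δ) (hu : 0 ≤ u) (huv : u ≤ v) : fp_L δ u ≤ fp_L δ v := by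
  have hv := hu.trans huv
  unfold fp_L
  rw [← Real.log_div (by positivity) (by positivity), ← Real.log_div (by positivity) (by positivity)]
  refine Real.log_le_log (by positivity) ?_
  rw [div_le_div_iff₀ (by positivity) (by positivity)]
  nlinarith

lemma fp_L_sg {δ a b : ℝ} (hδ : 0 < δ) (ha : 0 ≤ a) (hb : 0 ≤ b) :
    fp_L' δ a * (a - b) ≤ fp_L δ a - fp_L δ b := by
  -- concavity
  have hconc : ConcaveOn ℝ (Ici 0) (fp_L δ) := by
    refine concaveOn_of_hasDerivWithinAt2_nonpos (f' := fp_L' δ) (f'' := fp_L'' δ) (convex_Ici 0) ?_ ?_ ?_ ?_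
    · intro u hu
      exact (fp_L_d hδ hu).continuousAt.continuousWithinAt
    · intro u hu
      rw [interior_Ici] at hu
      exact (fp_L_d hδ (le_of_lt hu)).hasDerivWithinAt
    · intro u hu
      rw [interior_Ici] at hu
      exact (fp_L'_d hδ (le_of_lt hu)).hasDerivWithinAt
    · intro u hu
      rw [interior_Ici] at hu
      have := fp_L''_ge hδ (le_of_lt hu)
      nlinarith [sq_nonneg (fp_L' δ u)]
  have hd := fp_L_d hδ ha
  rcases lt_trichotomy a b with h | h | h
  · have := hconc.slope_le_of_hasDerivAt (x := a) (y := b) ha hb h hd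
    rw [slope_def_field, div_le_iff₀ (by linarith)] at this
    linarith
  · subst h; simp
  · have := hconc.le_slope_of_hasDerivAt (x := b) (y := a) hb ha h hd
    rw [slope_def_field, le_div_iff₀ (by linarith)] at this
    linarith

lemma fp_L_phi {δ : ℝ} (hδ : 0 < δ) : fp_Phi (fp_L δ) (fp_L' δ) (-fp_L δ 0) δ⁻¹ where
  cont := fun u hu => (fp_L_d hδ hu).continuousAt.continuousWithinAt
  cont' := fun u hu => (fp_L'_d hδ hu).continuousAt.continuousWithinAt
  K0 := neg_nonneg.2 (fp_L_np hδ le_rfl)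
  L0 := by positivity
  bd := fun a ha => by
    rw [abs_of_nonpos (fp_L_np hδ ha), neg_le_neg_iff]
    exact fp_L_anti hδ le_rfl ha
  bd' := fun a ha => by
    rw [abs_of_nonneg (fp_L'_pos hδ ha)]
    exact (fp_L'_le hδ ha).trans (inv_anti₀ hδ (by linarith))
  lip := fun a b ha hb => by
    have k : ∀ a b, 0 ≤ a → 0 ≤ b → a ≤ b → |fp_L δ a - fp_L δ b| ≤ δ⁻¹ * |a - b| := by
      intro a b ha hb hab
      have h1 := fp_L_anti hδ ha hab
      have h2 := fp_L_sg hδ ha hb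
      have h3 : fp_L' δ a ≤ δ⁻¹ := (fp_L'_le hδ ha).trans (inv_anti₀ hδ (by linarith))
      rw [abs_of_nonpos (by linarith), abs_of_nonpos (by linarith)]
      nlinarith
    rcases le_total a b with h | h
    · exact k a b ha hb h
    · rw [abs_sub_comm, abs_sub_comm a]; exact k b a hb ha h
  sg := fun a b ha hb => fp_L_sg hδ ha hb

lemma fp_L_C1 {m : ℕ} {δ : ℝ} (hδ : 0 < δ) {u : Spc m → ℝ} (hu : ContDiff ℝ 1 u) (h0 : ∀ x, 0 ≤ u x) :
    ContDiff ℝ 1 (fun x => fp_L δ (u x)) := by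
  unfold fp_L
  have a : ContDiff ℝ 1 (fun x => u x + δ) := hu.add contDiff_const
  exact (a.log fun x => by have := h0 x; positivity).sub
    ((a.add contDiff_const).log fun x => by have := h0 x; positivity)

lemma fp_L'_C1 {m : ℕ} {δ : ℝ} (hδ : 0 < δ) {u : Spc m → ℝ} (hu : ContDiff ℝ 1 u) (h0 : ∀ x, 0 ≤ u x) :
    ContDiff ℝ 1 (fun x => fp_L' δ (u x)) := by
  unfold fp_L'
  have a : ContDiff ℝ 1 (fun x => u x + δ) := hu.add contDiff_const
  exact (a.inv fun x => by have := h0 x; positivity).sub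
    ((a.add contDiff_const).inv fun x => by have := h0 x; positivity)

def fp_g1 {m : ℕ} (G : Spc m → ℝ) (x : Spc m) : ℝ := |pd (e1 m) G x| + ∑ i, |pd (eC m i) G x|

lemma fp_g1_cont {m : ℕ} {G : Spc m → ℝ} (h : ContDiff ℝ 1 G) : Continuous (fp_g1 G) := by
  unfold fp_g1
  exact (fp_pd_cont h _).abs.add (continuous_finsetSum _ fun i _ => (fp_pd_cont h _).abs)

lemma fp_gradDot_mul {m : ℕ} {f G : Spc m → ℝ} (V : Spc m → ℝ) (x : Spc m) (hf : Differentiable ℝ f)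
    (hG : Differentiable ℝ G) : gradDot (fun z => G z * f z) V x
      = G x * gradDot f V x + f x * gradDot G V x := by
  unfold gradDot
  simp only [fp_pd_mul _ hG hf, mul_add, Finset.mul_sum, add_mul, Finset.sum_add_distrib]
  have : ∀ i, G x * pd (eC m i) f x * pd (eC m i) V x = G x * (pd (eC m i) f x * pd (eC m i) V x) :=
    fun i => by ring
  have h2' : ∀ i, f x * pd (eC m i) G x * pd (eC m i) V x = f x * (pd (eC m i) G x * pd (eC m i) V x) :=
    fun i => by ring
  simp only [this, h2']
  ring

lemma fp_gradDot_comm {m : ℕ} (f g : Spc m → ℝ) (x : Spc m) : gradDot f g x = gradDot g f x := by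
  unfold gradDot
  simp only [mul_comm]

lemma fp_gradDot_nn {m : ℕ} (f : Spc m → ℝ) (x : Spc m) : 0 ≤ gradDot f f x :=
  add_nonneg (mul_self_nonneg _) (Finset.sum_nonneg fun i _ => mul_self_nonneg _)

lemma fp_lap_cont {m : ℕ} {G : Spc m → ℝ} (h : ContDiff ℝ 2 G) : Continuous (lap G) := by
  unfold lap
  exact (fp_pd_cont (fp_pd_C1 h _) _).add
    (continuous_finsetSum _ fun i _ => fp_pd_cont (fp_pd_C1 h _) _)

/-- energy inequality -/
lemma fp_energy {m : ℕ} {V u G : Spc m → ℝ} {β M δ : ℝ} (hβ : 0 < β) (hV : ContDiff ℝ 2 V)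
    (hVp : IsPeriodic V)
    (hup : IsPeriodic u) (hud : Differentiable ℝ u) (hug : Differentiable ℝ (grd u))
    (hm : ∀ x1, 0 < marg u x1) (h0 : ∀ x, 0 ≤ u x)
    (hi : Integrable (fun x => β⁻¹ * lap u x + Fop V u x) (μT m))
    (hM1 : ∀ x, |pd (e1 m) V x| ≤ M) (hM2 : ∀ i x, |pd (eC m i) V x| ≤ M)
    (hδ : 0 < δ) (hG : ContDiff ℝ 2 G) (hGp : IsPeriodic G) (hG0 : ∀ x, 0 ≤ G x) :
    β⁻¹ * ∫ x, lap G x * fp_L δ (u x) ∂(μT m)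
      + β⁻¹ / 2 * ∫ x, G x * gradDot (fun z => fp_L δ (u z)) (fun z => fp_L δ (u z)) x ∂(μT m)
      - β * ((m + 2) * M ^ 2) * ∫ x, G x ∂(μT m) - 2 * M * ∫ x, fp_g1 G x ∂(μT m)
    ≤ ∫ x, G x * fp_L' δ (u x) * (β⁻¹ * lap u x + Fop V u x) ∂(μT m) := by
  have hu := fp_C1 hud hug
  have hG1 : ContDiff ℝ 1 G := hG.of_le (by norm_num)
  have hGd := hG1.differentiable (by norm_num)
  have hL := fp_L_C1 hδ hu h0
  have hLd := hL.differentiable (by norm_num)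
  have hL' := fp_L'_C1 hδ hu h0
  have hL'd := hL'.differentiable (by norm_num)
  obtain ⟨i1, i2, i3⟩ := fp_ibp (w := fun x => G x * fp_L' δ (u x)) (β := β) hV hVp hup hud hug hm
      (hG1.mul hL') (fp_per_mul hGp (fp_per_comp hup _)) hi
  rw [i3]
  have hdd : ∀ v, Differentiable ℝ (pd v G) := fun v => (fp_pd_C1 hG v).differentiable (by norm_num)
  have eqd : ∀ x, pd (e1 m) (fun z => fp_L δ (u z) * pd (e1 m) G z) x
      + ∑ i, pd (eC m i) (fun z => fp_L δ (u z) * pd (eC m i) G z) x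
      = gradDot (fun z => fp_L δ (u z)) G x + lap G x * fp_L δ (u x) := by
    intro x
    unfold gradDot lap
    simp only [fp_pd_mul _ hLd (hdd _), Finset.sum_add_distrib, add_mul, Finset.sum_mul]
    have : ∀ i, fp_L δ (u x) * pd (eC m i) (pd (eC m i) G) x
      = pd (eC m i) (pd (eC m i) G) x * fp_L δ (u x) := fun i => by ring
    have h2 : ∀ i, pd (eC m i) G x * pd (eC m i) (fun z => fp_L δ (u z)) x
      = pd (eC m i) (fun z => fp_L δ (u z)) x * pd (eC m i) G x := fun i => by ring
    simp only [this, h2]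
    ring
  have cd : Continuous (fun x => gradDot (fun z => fp_L δ (u z)) G x + lap G x * fp_L δ (u x)) :=
    (fp_gradDot_cont hL hG1).add ((fp_lap_cont hG).mul hL.continuous)
  have hdiv := fp_div (fun z => fp_L δ (u z) * pd (e1 m) G z) (fun i z => fp_L δ (u z) * pd (eC m i) G z)
    (fp_per_mul (fp_per_comp hup _) (fp_per_pd hGp _)) (fun i => fp_per_mul (fp_per_comp hup _) (fp_per_pd hGp _))
    (hLd.mul (hdd _)) (fun i => hLd.mul (hdd _)) (by simp only [eqd]; exact fp_int cd)
  simp only [eqd] at hdiv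
  have I0 : fp_I _ 0 := ⟨fp_int cd, hdiv⟩
  have I1 := fp_I.ofc (f := fun x => lap G x * fp_L δ (u x)) ((fp_lap_cont hG).mul hL.continuous)
  have I2 := fp_I.ofc (f := fun x => G x * gradDot (fun z => fp_L δ (u z)) (fun z => fp_L δ (u z)) x) (hG1.continuous.mul (fp_gradDot_cont hL hL))
  have I3 := fp_I.ofc hG1.continuous
  have I4 := fp_I.ofc (fp_g1_cont hG1)
  have key := fp_I.mono (fp_I.of i2) (((((I0.cm β⁻¹).sub (I1.cm β⁻¹)).sub (I2.cm (β⁻¹ / 2))).add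
    (I3.cm (β * ((m + 2) * M ^ 2)))).add (I4.cm (2 * M))) ?_
  · linarith
  intro x _
  have hd := fp_L_d hδ (h0 x)
  have hd' := fp_L'_d hδ (h0 x)
  simp only [fp_gradDot_mul _ x hL'd hGd, fp_pd_mul _ hGd hL'd, fp_gradDot_comp _ x hd' hud,
    fp_pd_comp _ x hd' hud, fp_gradDot_comp _ x hd hud]
  rw [fp_gradDot_comm u (fun z => fp_L δ (u z)), fp_gradDot_comp _ x hd hud, fp_gradDot_comm u G]
  have hφ := fp_phi_bd (V := V) hu.continuous h0 hm hM1 x.1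
  set φ := phiF V u x.1
  have hB : gradDot V V x + φ ^ 2 ≤ (m + 2) * M ^ 2 := by
    have sq : ∀ a : ℝ, |a| ≤ M → a * a ≤ M ^ 2 := fun a ha => by
      have := abs_le.1 ha
      nlinarith
    have s1 : ∑ i, pd (eC m i) V x * pd (eC m i) V x ≤ m * M ^ 2 := by
      refine (Finset.sum_le_sum fun i _ => sq _ (hM2 i x)).trans ?_
      simp
    have s2 := sq _ (hM1 x)
    have s3 := sq _ hφ
    unfold gradDot
    nlinarith
  have hA := fp_alg hβ u V x (u x) φ _ hB
  have hg : |gradDot G V x - φ * pd (e1 m) G x| ≤ 2 * M * fp_g1 G x := by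
    have s1 : |∑ i, pd (eC m i) G x * pd (eC m i) V x| ≤ M * ∑ i, |pd (eC m i) G x| := by
      refine (Finset.abs_sum_le_sum_abs _ _).trans ?_
      rw [Finset.mul_sum]
      refine Finset.sum_le_sum fun i _ => ?_
      rw [abs_mul, mul_comm]
      exact mul_le_mul_of_nonneg_right (hM2 i x) (abs_nonneg _)
    have s2 : |pd (e1 m) G x * pd (e1 m) V x| ≤ M * |pd (e1 m) G x| := by
      rw [abs_mul, mul_comm]
      exact mul_le_mul_of_nonneg_right (hM1 x) (abs_nonneg _)
    have s3 : |φ * pd (e1 m) G x| ≤ M * |pd (e1 m) G x| := by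
      rw [abs_mul]
      exact mul_le_mul_of_nonneg_right hφ (abs_nonneg _)
    have s4 : 0 ≤ M * ∑ i, |pd (eC m i) G x| := (abs_nonneg _).trans s1
    unfold gradDot fp_g1
    rw [abs_le] at *
    constructor <;> linarith [s1.1, s1.2, s2.1, s2.2, s3.1, s3.2]
  have hp := fp_L'_pos hδ (h0 x)
  have hpu : 0 ≤ fp_L' δ (u x) * u x := mul_nonneg hp (h0 x)
  have hpm := fp_L'_mul hδ (h0 x)
  have hg' : fp_L' δ (u x) * u x * (gradDot G V x - φ * pd (e1 m) G x) ≤ 2 * M * fp_g1 G x := by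
    refine (le_abs_self _).trans ?_
    rw [abs_mul, abs_of_nonneg hpu]
    exact (mul_le_of_le_one_left (abs_nonneg _) hpm).trans hg
  have q1 := fp_L''_ge hδ (h0 x)
  have q2 := fp_L''_mul hδ (h0 x)
  have q3 := fp_gradDot_nn u x
  have hM0 : 0 ≤ β * ((m + 2) * M ^ 2) := by positivity
  have hb : 0 ≤ β⁻¹ / 2 := by positivity
  have r0 : 0 ≤ - fp_L'' δ (u x) := (sq_nonneg _).trans q1
  have r1 := mul_le_mul_of_nonneg_left hA r0
  have r2 := mul_le_mul_of_nonneg_right q1 (mul_nonneg hb q3)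
  have r3 := mul_le_mul_of_nonneg_right q2 hM0
  have r4 : fp_L'' δ (u x) * (β⁻¹ * gradDot u u x + u x * gradDot u V x - φ * u x * pd (e1 m) u x)
    ≤ - (β⁻¹ / 2 * (fp_L' δ (u x) ^ 2 * gradDot u u x)) + β * ((m + 2) * M ^ 2) := by nlinarith
  have r5 := mul_le_mul_of_nonneg_left r4 (hG0 x)
  linarith

lemma fp_fd_le {m : ℕ} (f : Spc m → ℝ) (x w : Spc m) (hw : ‖w‖ ≤ 1) : |fderiv ℝ f x w| ≤ fp_g1 f x := by
  have hw2 : w = w.1 • e1 m + ∑ i, w.2 i • eC m i := by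
    ext i
    · simp [e1, eC, Prod.fst_sum]
    · simp [e1, eC, Prod.snd_sum, Finset.sum_apply, Pi.single_apply]
  have h1 : |w.1| ≤ 1 := (norm_fst_le w).trans hw
  have h2 : ∀ i, |w.2 i| ≤ 1 := fun i => ((norm_le_pi_norm w.2 i).trans (norm_snd_le w)).trans hw
  conv_lhs => rw [hw2]
  rw [map_add, map_sum]
  simp only [map_smul, smul_eq_mul]
  unfold fp_g1 pd
  refine (abs_add_le _ _).trans (add_le_add ?_ ((Finset.abs_sum_le_sum_abs _ _).trans
    (Finset.sum_le_sum fun i _ => ?_)))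
  · rw [abs_mul]; exact mul_le_of_le_one_left (abs_nonneg _) h1
  · rw [abs_mul]; exact mul_le_of_le_one_left (abs_nonneg _) (h2 i)

open Pointwise in
lemma fp_scale {m : ℕ} {g : Spc m → ℝ} (hg : Continuous g) (h0 : ∀ x, 0 ≤ g x) {z : Spc m}
    (hz : z ∈ cube m) {s : ℝ} (hs : s ∈ Icc (1/2:ℝ) 1) :
    ∫ x, g (z + s • (x - z)) ∂(μT m) ≤ 2 ^ (m + 1) * ∫ x, g x ∂(μT m) := by
  have hs0 : 0 < s := by linarith [hs.1]
  have e1 : ∀ x, z + s • (x - z) = (z - s • z) + s • x := fun x => by rw [smul_sub]; abel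
  simp only [e1]
  unfold μT
  have : (volume : Measure (Spc m)).IsAddHaarMeasure :=
    inferInstanceAs ((volume : Measure ℝ).prod (volume : Measure (Fin m → ℝ))).IsAddHaarMeasure
  rw [Measure.setIntegral_comp_smul_of_pos volume (fun y => g ((z - s • z) + y)) (cube m) hs0]
  have hfr : Module.finrank ℝ (Spc m) = m + 1 := by
    simp [Module.finrank_prod, add_comm]
  rw [hfr, smul_eq_mul]
  have h2 : (s ^ (m + 1))⁻¹ ≤ 2 ^ (m + 1) := by
    rw [← inv_pow]
    refine pow_le_pow_left₀ (by positivity) ?_ _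
    rw [inv_le_comm₀ hs0 (by norm_num)]
    linarith [hs.1]
  have h3 : ∫ x in s • cube m, g ((z - s • z) + x) ≤ ∫ x in cube m, g x := by
    have := (measurePreserving_add_left (volume : Measure (Spc m)) (z - s • z)).setIntegral_preimage_emb
      (MeasurableEquiv.addLeft (z - s • z)).measurableEmbedding g
      ((fun y => (z - s • z) + y) '' (s • cube m))
    rw [preimage_image_eq _ (add_right_injective _)] at this
    rw [this]
    refine setIntegral_mono_set (fp_int hg) (Eventually.of_forall h0) (LE.le.eventuallyLE ?_)
    rintro _ ⟨_, ⟨x, hx, rfl⟩, rfl⟩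
    have hx' := hx
    have hz' := hz
    simp only [cube, cube1, mem_prod, Set.mem_pi, mem_univ, true_implies, mem_Ico] at hx hz ⊢
    simp only [Prod.fst_add, Prod.fst_sub, Prod.smul_fst, Prod.snd_add, Prod.snd_sub, Prod.smul_snd,
      Pi.add_apply, Pi.sub_apply, Pi.smul_apply, smul_eq_mul]
    have k : ∀ a b : ℝ, 0 ≤ a ∧ a < 1 → 0 ≤ b ∧ b < 1 →
      0 ≤ b - s * b + s * a ∧ b - s * b + s * a < 1 := by
      intro a b ha hb
      have := hs.2
      constructor
      · nlinarith [mul_nonneg hs0.le ha.1, mul_nonneg (sub_nonneg.2 this) hb.1]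
      · nlinarith [mul_lt_mul_of_pos_left ha.2 hs0, mul_le_mul_of_nonneg_left hb.2.le (sub_nonneg.2 this)]
    exact ⟨k _ _ hx.1 hz.1, fun i => k _ _ (hx.2 i) (hz.2 i)⟩
  have h4 : 0 ≤ ∫ x in s • cube m, g ((z - s • z) + x) := integral_nonneg fun x => h0 _
  exact mul_le_mul h2 h3 h4 (by positivity)

lemma fp_poinc {m : ℕ} {l ω : Spc m → ℝ} (hl : ContDiff ℝ 1 l) (hω : Continuous ω)
    (hω0 : ∀ x, 0 ≤ ω x) (hω1 : ∀ x, ω x ≤ 1) (hlω : ∀ x, -1 ≤ ω x * l x) :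
    - (∫ x, ω x ∂(μT m)) * (∫ x, l x ∂(μT m)) - 1 ≤ 2 ^ (m + 1) * ∫ x, fp_g1 l x ∂(μT m) := by
  set g := fp_g1 l with hgdef
  have hg : Continuous g := fp_g1_cont hl
  have hg0 : ∀ x, 0 ≤ g x := fun x => add_nonneg (abs_nonneg _) (Finset.sum_nonneg fun _ _ => abs_nonneg _)
  set ν : Measure ℝ := volume.restrict (Ioc (1/2:ℝ) 1) with hν
  set F : Spc m × Spc m × ℝ → ℝ := fun p => g (p.2.1 + p.2.2 • (p.1 - p.2.1)) with hF
  have hFc : Continuous F := by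
    have : Continuous fun p : Spc m × Spc m × ℝ => p.2.1 + p.2.2 • (p.1 - p.2.1) := by fun_prop
    exact hg.comp this
  have hprod : (μT m).prod ((μT m).prod ν) = (volume : Measure (Spc m × Spc m × ℝ)).restrict
      (cube m ×ˢ (cube m ×ˢ Ioc (1/2:ℝ) 1)) := by
    simp only [μT, hν, Measure.prod_restrict]; rfl
  have hprod2 : (μT m).prod (μT m) = (volume : Measure (Spc m × Spc m)).restrict
      (cube m ×ˢ cube m) := by
    simp only [μT, Measure.prod_restrict]; rfl
  have hFi : Integrable F ((μT m).prod ((μT m).prod ν)) := by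
    rw [hprod]
    refine IntegrableOn.mono_set (t := Icc 0 1 ×ˢ (Icc 0 1 ×ˢ Icc (1/2:ℝ) 1)) ?_
      (prod_mono fp_cube_sub (prod_mono fp_cube_sub Ioc_subset_Icc_self))
    exact hFc.continuousOn.integrableOn_compact (isCompact_Icc.prod (isCompact_Icc.prod isCompact_Icc))
  have hint2 : ∀ {f : Spc m × Spc m → ℝ}, Continuous f → Integrable f ((μT m).prod (μT m)) := by
    intro f hf
    rw [hprod2]
    refine IntegrableOn.mono_set (t := Icc 0 1 ×ˢ Icc 0 1) ?_ (prod_mono fp_cube_sub fp_cube_sub)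
    exact hf.continuousOn.integrableOn_compact (isCompact_Icc.prod isCompact_Icc)
  set P : Spc m × Spc m → ℝ := fun p => ∫ s, F (p.1, p.2, s) ∂ν with hP
  set I := ∫ x, g x ∂(μT m) with hI
  have hI0 : 0 ≤ I := integral_nonneg hg0
  -- integral of P
  have hPi : Integrable P ((μT m).prod (μT m)) := by
    have := (measurePreserving_prodAssoc (μT m) (μT m) ν).integrable_comp_emb
      (MeasurableEquiv.prodAssoc).measurableEmbedding (g := F)
    exact (this.2 hFi).integral_prod_left
  have hPI : ∫ p, P p ∂((μT m).prod (μT m)) ≤ 2 ^ (m + 1) * I / 2 := by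
    have e1 : ∫ p, P p ∂((μT m).prod (μT m)) = ∫ q, F q ∂((μT m).prod ((μT m).prod ν)) := by
      have h2 := (measurePreserving_prodAssoc (μT m) (μT m) ν).integral_comp
        (MeasurableEquiv.prodAssoc).measurableEmbedding F
      have h3 := integral_prod _ (((measurePreserving_prodAssoc (μT m) (μT m) ν).integrable_comp_emb
          (MeasurableEquiv.prodAssoc).measurableEmbedding (g := F)).2 hFi)
      exact h3.symm.trans h2
    rw [e1, integral_prod_symm _ hFi]
    have e2 : (2:ℝ) ^ (m + 1) * I / 2 = ∫ _q : Spc m × ℝ, 2 ^ (m + 1) * I ∂((μT m).prod ν) := by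
      rw [integral_const]
      have : ((μT m).prod ν).real univ = 1 / 2 := by
        rw [← univ_prod_univ, measureReal_prod_prod]
        simp [hν]
        norm_num
      rw [this, smul_eq_mul]; ring
    rw [e2]
    refine integral_mono_ae hFi.integral_prod_right (integrable_const _) ?_
    have hae : ∀ᵐ q ∂((μT m).prod ν), q ∈ cube m ×ˢ Ioc (1/2:ℝ) 1 := by
      have : (μT m).prod ν = ((volume : Measure (Spc m)).prod volume).restrict (cube m ×ˢ Ioc (1/2:ℝ) 1) := by
        simp only [μT, hν, Measure.prod_restrict]
      rw [this]
      exact ae_restrict_mem ((fp_cube_meas m).prod measurableSet_Ioc)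
    filter_upwards [hae] with q hq
    exact fp_scale hg hg0 hq.1 ⟨hq.2.1.le, hq.2.2⟩
  -- pointwise bound
  have hpt : ∀ x ∈ cube m, ∀ z ∈ cube m, |l x - l (z + (1/2:ℝ) • (x - z))| ≤ P (x, z) := by
    intro x hx z hz
    have hxz : ‖x - z‖ ≤ 1 := by
      have hx' := fp_cube_sub hx
      have hz' := fp_cube_sub hz
      rw [norm_prod_le_iff]
      constructor
      · rw [Real.norm_eq_abs, abs_le]
        have := hx'.1.1; have := hx'.2.1; have := hz'.1.1; have := hz'.2.1
        simp only [Prod.fst_zero, Prod.fst_one, Prod.fst_sub] at *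
        constructor <;> linarith
      · rw [pi_norm_le_iff_of_nonneg zero_le_one]
        intro i
        rw [Real.norm_eq_abs, abs_le]
        have := hx'.1.2 i; have := hx'.2.2 i; have := hz'.1.2 i; have := hz'.2.2 i
        simp only [Prod.snd_zero, Prod.snd_one, Prod.snd_sub, Pi.sub_apply, Pi.zero_apply, Pi.one_apply] at *
        constructor <;> linarith
    have hd : ∀ s : ℝ, HasDerivAt (fun s : ℝ => l (z + s • (x - z)))
        (fderiv ℝ l (z + s • (x - z)) (x - z)) s := by
      intro s
      have a1 : HasDerivAt (fun s : ℝ => z + s • (x - z)) (x - z) s := by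
        have := ((hasDerivAt_id s).smul_const (x - z)).const_add z
        simpa using this
      exact ((hl.differentiable (by norm_num)) _).hasFDerivAt.comp_hasDerivAt s a1
    have hcd : Continuous fun s : ℝ => fderiv ℝ l (z + s • (x - z)) (x - z) := by
      have := (hl.continuous_fderiv (by norm_num)).comp (show Continuous fun s : ℝ => z + s • (x - z) by fun_prop)
      exact this.clm_apply continuous_const
    have hft := intervalIntegral.integral_eq_sub_of_hasDerivAt (a := 1/2) (b := 1) (fun s _ => hd s)
      (hcd.intervalIntegrable _ _)
    rw [one_smul, add_sub_cancel] at hft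
    rw [← hft, intervalIntegral.integral_of_le (by norm_num), ← Real.norm_eq_abs]
    refine norm_integral_le_of_norm_le ?_ (Eventually.of_forall fun s => fp_fd_le _ _ _ hxz)
    refine IntegrableOn.mono_set (t := Icc (1/2:ℝ) 1) ?_ Ioc_subset_Icc_self
    refine ContinuousOn.integrableOn_compact isCompact_Icc (Continuous.continuousOn ?_)
    exact hg.comp (by fun_prop)
  have hsw : ∫ p : Spc m × Spc m, P (p.2, p.1) ∂((μT m).prod (μT m)) = ∫ p, P p ∂((μT m).prod (μT m)) :=
    integral_prod_swap P
  have hswi : Integrable (fun p : Spc m × Spc m => P (p.2, p.1)) ((μT m).prod (μT m)) := hPi.swap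
  have hc1 : Continuous (fun p : Spc m × Spc m => 1 * (ω p.2 * l p.2)) := by
    have := hl.continuous; fun_prop
  have hc2 : Continuous (fun p : Spc m × Spc m => l p.1 * ω p.2) := by
    have := hl.continuous; fun_prop
  have hmain : ∫ p : Spc m × Spc m, (1 * (ω p.2 * l p.2) - l p.1 * ω p.2) ∂((μT m).prod (μT m))
      ≤ ∫ p : Spc m × Spc m, (P p + P (p.2, p.1)) ∂((μT m).prod (μT m)) := by
    refine integral_mono_ae ((hint2 hc1).sub (hint2 hc2)) (hPi.add hswi) ?_
    have hae : ∀ᵐ q ∂((μT m).prod (μT m)), q ∈ cube m ×ˢ cube m := by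
      rw [hprod2]
      exact ae_restrict_mem ((fp_cube_meas m).prod (fp_cube_meas m))
    filter_upwards [hae] with q hq
    have b1 := hpt q.1 hq.1 q.2 hq.2
    have b2 := hpt q.2 hq.2 q.1 hq.1
    have e : q.1 + (1/2:ℝ) • (q.2 - q.1) = q.2 + (1/2:ℝ) • (q.1 - q.2) := by module
    rw [e] at b2
    have b3 : l q.2 - l q.1 ≤ P q + P (q.2, q.1) := by
      have := (abs_le.1 b1).1
      have := (abs_le.1 b2).2
      linarith
    have b4 : 0 ≤ P q + P (q.2, q.1) := add_nonneg ((abs_nonneg _).trans b1) ((abs_nonneg _).trans b2)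
    have := hω0 q.2
    have := hω1 q.2
    nlinarith
  have s1 : ∫ p : Spc m × Spc m, 1 * (ω p.2 * l p.2) ∂((μT m).prod (μT m)) = ∫ x, ω x * l x ∂(μT m) := by
    rw [integral_prod_mul (fun _ => (1:ℝ)) (fun z => ω z * l z)]
    simp
  have s2 : ∫ p : Spc m × Spc m, l p.1 * ω p.2 ∂((μT m).prod (μT m))
    = (∫ x, l x ∂(μT m)) * ∫ x, ω x ∂(μT m) := integral_prod_mul l ω
  rw [integral_sub (hint2 hc1) (hint2 hc2), integral_add hPi hswi, hsw, s1, s2] at hmain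
  have s3 := fp_I.mono (fp_I.const m (-1)) (fp_I.ofc (f := fun x => ω x * l x) (hω.mul hl.continuous))
    (fun x _ => hlω x)
  linarith

lemma fp_riccati {f g : ℝ → ℝ} {a b c C R : ℝ} (hab : a < b) (hc : 0 < c) (hC : 0 ≤ C) (hR : 0 ≤ R)
    (hf : ContinuousOn f (Icc a b)) (hd : ∀ τ ∈ Ioc a b, fp_LD f τ (g τ))
    (h1 : ∀ τ ∈ Ioc a b, -C ≤ g τ) (h2 : ∀ τ ∈ Ioc a b, f τ ≤ -R → c * f τ ^ 2 ≤ g τ) :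
    -(R + C * (b - a) + 1 / (c * (b - a))) ≤ f b := by
  by_contra! hlt
  have hba : 0 < b - a := by linarith
  have hpos : 0 < 1 / (c * (b - a)) := by positivity
  have hs : ∀ s ∈ Icc a b, f s < -R - 1 / (c * (b - a)) := by
    intro s hs
    have := fp_mono' (f := f) (H := fun τ => -C * τ) (g := fun _ => -C) hs.2
      (hf.mono (Icc_subset_Icc hs.1 le_rfl))
      (fun τ hτ => fp_LD_mono (hd τ ⟨hs.1.trans_lt hτ.1, hτ.2⟩) (h1 τ ⟨hs.1.trans_lt hτ.1, hτ.2⟩))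
      (by fun_prop) (fun τ _ => by simpa using (hasDerivAt_id τ).const_mul (-C))
    have h3 := hs.1
    nlinarith
  have hneg : ∀ s ∈ Icc a b, f s < 0 := fun s h => by linarith [hs s h]
  have := fp_mono' (f := fun s => -(f s)⁻¹) (H := fun τ => c * τ) (g := fun _ => c) hab.le
    ((hf.inv₀ fun s h => (hneg s h).ne).neg) ?_ (by fun_prop)
    (fun τ _ => by simpa using (hasDerivAt_id τ).const_mul c)
  · have e1 : (f a)⁻¹ < 0 := inv_lt_zero.2 (hneg a ⟨le_rfl, hab.le⟩)
    have e2 : -(f b)⁻¹ ≤ c * (b - a) := by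
      have : 1 / (c * (b - a)) ≤ - f b := by linarith [hs b ⟨hab.le, le_rfl⟩]
      rw [← inv_neg]
      refine inv_le_of_inv_le₀ (by positivity) ?_
      rwa [← one_div]
    linarith
  · intro τ hτ ε hε
    have hτ' : τ ∈ Icc a b := ⟨hτ.1.le, hτ.2⟩
    set p := f τ with hp
    have hp0 : p < 0 := hneg τ hτ'
    have hpn : p ≠ 0 := hp0.ne
    have hp2 : 0 < p ^ 2 := by positivity
    have hgl := h2 τ hτ (by linarith [hs τ hτ'])
    have t1 : Tendsto (fun h => τ - h) (nhdsWithin 0 (Ioi 0)) (nhdsWithin τ (Icc a b)) := by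
      refine tendsto_nhdsWithin_iff.2 ⟨?_, ?_⟩
      · have : Tendsto (fun h : ℝ => τ - h) (nhds 0) (nhds (τ - 0)) :=
          Continuous.tendsto (by fun_prop) _
        rw [sub_zero] at this
        exact this.mono_left nhdsWithin_le_nhds
      · have q : ∀ᶠ h in nhdsWithin (0:ℝ) (Ioi 0), h < τ - a :=
          nhdsWithin_le_nhds (Iio_mem_nhds (by linarith [hτ.1]))
        filter_upwards [q, self_mem_nhdsWithin] with h a1 a2
        have a2' : 0 < h := a2
        exact ⟨by linarith, by linarith [hτ.2]⟩
    have t2 : Tendsto (fun h => f (τ - h)) (nhdsWithin 0 (Ioi 0)) (nhds p) :=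
      (hf τ hτ').tendsto.comp t1
    have t3 : Tendsto (fun h => (c * p ^ 2 - ε * p ^ 2 / 2) / (p * f (τ - h))) (nhdsWithin 0 (Ioi 0))
        (nhds ((c * p ^ 2 - ε * p ^ 2 / 2) / (p * p))) :=
      tendsto_const_nhds.div (tendsto_const_nhds.mul t2) (mul_ne_zero hpn hpn)
    have e3 : (c * p ^ 2 - ε * p ^ 2 / 2) / (p * p) = c - ε / 2 := by
      field_simp
    rw [e3] at t3
    filter_upwards [t3.eventually (lt_mem_nhds (show c - ε < c - ε / 2 by linarith)),
      t2.eventually (gt_mem_nhds hp0), hd τ hτ (ε * p ^ 2 / 2) (by positivity),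
      self_mem_nhdsWithin] with h b1 b2 b3 b4
    have b4' : 0 < h := b4
    have hpr : 0 < p * f (τ - h) := mul_pos_of_neg_of_neg hp0 b2
    rw [lt_div_iff₀ hpr] at b1
    have e4 : -p⁻¹ - -(f (τ - h))⁻¹ = (p - f (τ - h)) / (p * f (τ - h)) := by
      field_simp [hp0.ne, b2.ne]
      ring
    rw [e4, le_div_iff₀ hpr]
    nlinarith [mul_le_mul_of_nonneg_right b1.le b4'.le]

lemma fp_min_L {δ u : ℝ} (hδ : 0 < δ) (hu : 0 ≤ u) : -1 ≤ min u 1 * fp_L δ u := by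
  have h1 : -fp_L δ u ≤ (u + δ)⁻¹ := by
    unfold fp_L
    rw [neg_sub, ← Real.log_div (by positivity) (by positivity)]
    refine (Real.log_le_sub_one_of_pos (by positivity)).trans (le_of_eq ?_)
    field_simp
    ring
  have h2 : min u 1 * (-fp_L δ u) ≤ u * (u + δ)⁻¹ :=
    mul_le_mul (min_le_left _ _) h1 (by linarith [fp_L_np hδ hu]) hu
  have h3 : u * (u + δ)⁻¹ ≤ 1 := by
    rw [← div_eq_mul_inv, div_le_one (by positivity)]; linarith
  linarith

lemma fp_g1_sq {m : ℕ} (l : Spc m → ℝ) (x : Spc m) :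
    fp_g1 l x ^ 2 ≤ (m + 1) * gradDot l l x := by
  have h := sq_sum_le_card_mul_sum_sq (s := (Finset.univ : Finset (Option (Fin m))))
    (f := fun o => Option.elim o |pd (e1 m) l x| (fun i => |pd (eC m i) l x|))
  simp only [Fintype.sum_option, Option.elim, sq_abs, Finset.card_univ, Fintype.card_option,
    Fintype.card_fin] at h
  unfold fp_g1 gradDot
  push_cast at h
  simpa only [sq] using h

lemma fp_Ker_one {m : ℕ} (a b : ℝ) : fp_Ker (m := m) a b (fun _ _ => 1) (fun _ _ => 0) where
  der := fun τ _ x => hasDerivAt_const _ _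
  jc := continuousOn_const
  jct := continuousOn_const
  c := fun _ _ => continuous_const
  ct := fun _ _ => continuous_const
  nn := fun _ _ _ => zero_le_one

lemma fp_pd_c {m : ℕ} (v : Spc m) (c : ℝ) : pd v (fun _ : Spc m => c) = fun _ => 0 := by
  funext x
  simp [pd]

lemma fp_H {m : ℕ} {V : Spc m → ℝ} {β T M : ℝ} {ψ : ℝ → Spc m → ℝ} (hβ : 0 < β)
    (hV : ContDiff ℝ 2 V) (hVp : IsPeriodic V) (S : fp_Sol V β T ψ)
    (hn : ∀ t ∈ Icc 0 T, ∀ x, 0 ≤ ψ t x) (hM1 : ∀ x, |pd (e1 m) V x| ≤ M)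
    (hM2 : ∀ i x, |pd (eC m i) V x| ≤ M) {a b : ℝ} (ha : 0 < a) (hab : a < b) (hb : b ≤ T) :
    ∃ K, 0 ≤ K ∧ ∀ δ > 0, -K ≤ ∫ x, fp_L δ (ψ b x) ∂(μT m) := by
  have hsub : Icc a b ⊆ Icc 0 T := Icc_subset_Icc ha.le hb
  have hmin : ∀ a b : ℝ, |min a 1 - min b 1| ≤ |a - b| := fun a b => by
    simpa using abs_min_sub_min_le_max a 1 b 1
  have hκc := (fp_contY1 S (Φ := fun a => min a 1) (by fun_prop) hmin).mono hsub
  obtain ⟨s, hs, hsm⟩ := isCompact_Icc.exists_isMinOn (nonempty_Icc.2 hab.le) hκc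
  set κ := ∫ x, min (ψ s x) 1 ∂(μT m) with hκ
  have hs0 : s ∈ Ioc 0 T := ⟨ha.trans_le hs.1, hs.2.trans hb⟩
  have hκ0 : 0 < κ := by
    have hc : Continuous (fun x => min (ψ s x) 1) := (S.cont s (hsub hs)).min continuous_const
    have h0 : ∀ x, 0 ≤ min (ψ s x) 1 := fun x => le_min (hn s (hsub hs) x) zero_le_one
    refine lt_of_le_of_ne (integral_nonneg h0) fun h => ?_
    have hz := (integral_eq_zero_iff_of_nonneg h0 (fp_int hc)).1 h.symm
    have hz' := fp_ico_mem (fp_per_comp (S.per s hs0) (fun a => min a 1)) hc hz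
    have : ∀ x, ψ s x = 0 := fun x => by
      have := hz' x
      rcases min_choice (ψ s x) 1 with h | h <;> rw [h] at this
      · exact this
      · norm_num at this
    have h3 := S.marg s hs0 0
    simp [marg, this] at h3
  set C := β * ((m + 2) * M ^ 2) with hCd
  have hC : 0 ≤ C := by positivity
  set c := β⁻¹ / 2 / (m + 1) * (κ / 2 ^ (m + 2)) ^ 2 with hcd
  have hc : 0 < c := by positivity
  set R := 2 / κ + 2 * C / c + 1 with hRd
  have hR : 0 ≤ R := by positivity
  refine ⟨R + C * (b - a) + 1 / (c / 2 * (b - a)), ?_, fun δ hδ => ?_⟩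
  · have : 0 < b - a := by linarith
    positivity
  set ℓ := fun τ x => fp_L δ (ψ τ x) with hℓ
  set A := fun τ => ∫ x, fp_g1 (ℓ τ) x ∂(μT m) with hA
  have hA0 : ∀ τ, 0 ≤ A τ := fun τ => integral_nonneg fun x =>
    add_nonneg (abs_nonneg _) (Finset.sum_nonneg fun _ _ => abs_nonneg _)
  have hYc := fp_Y_cont S hn (fp_L_phi hδ) ha.le hb (fp_Ker_one a b)
  have hYd := fun τ (hτ : τ ∈ Ioc a b) => fp_Y_dini S hn (fp_L_phi hδ) ha.le hb (fp_Ker_one a b) hτ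
  have e1 : ∀ τ, ∫ x, 1 * fp_L δ (ψ τ x) ∂(μT m) = ∫ x, fp_L δ (ψ τ x) ∂(μT m) := fun τ => by
    simp only [one_mul]
  simp only [e1] at hYc hYd
  have hτT : ∀ τ ∈ Ioc a b, τ ∈ Ioc 0 T := fun τ hτ => ⟨ha.trans hτ.1, hτ.2.trans hb⟩
  have hτT' : ∀ τ ∈ Ioc a b, τ ∈ Icc 0 T := fun τ hτ => ⟨(ha.trans hτ.1).le, hτ.2.trans hb⟩
  have hℓ1 : ∀ τ ∈ Ioc a b, ContDiff ℝ 1 (ℓ τ) := fun τ hτ =>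
    fp_L_C1 hδ (fp_C1 (S.diff τ (hτT τ hτ)) (S.diff2 τ (hτT τ hτ))) (hn τ (hτT' τ hτ))
  refine fp_riccati (g := fun τ => β⁻¹ / 2 / (m + 1) * A τ ^ 2 - C) hab (by positivity) hC hR hYc ?_ ?_ ?_
  · intro τ hτ
    refine fp_LD_mono (hYd τ hτ) ?_
    have E := fp_energy (G := fun _ => 1) hβ hV hVp (S.per τ (hτT τ hτ)) (S.diff τ (hτT τ hτ))
      (S.diff2 τ (hτT τ hτ)) (S.marg τ (hτT τ hτ)) (hn τ (hτT' τ hτ)) (S.intv τ (hτT τ hτ))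
      hM1 hM2 hδ contDiff_const (fp_per_const 1) (fun _ => zero_le_one)
    have l0 : ∀ x, lap (fun _ : Spc m => (1:ℝ)) x = 0 := fun x => by
      simp [lap, fp_pd_c]
    have g0 : ∀ x, fp_g1 (fun _ : Spc m => (1:ℝ)) x = 0 := fun x => by
      simp [fp_g1, fp_pd_c]
    simp only [l0, g0, zero_mul, integral_zero, mul_zero, zero_add, sub_zero, one_mul] at E
    have i1 : ∫ x, (1:ℝ) ∂(μT m) = 1 := by simp
    rw [i1, mul_one] at E
    simp only [zero_mul, integral_zero, zero_add, one_mul]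
    refine le_trans ?_ E
    have hl := hℓ1 τ hτ
    have I1 : fp_I (fun x => fp_g1 (ℓ τ) x) (A τ) := fp_I.ofc (fp_g1_cont hl)
    have I2 : fp_I (fun x => gradDot (ℓ τ) (ℓ τ) x) (∫ x, gradDot (ℓ τ) (ℓ τ) x ∂(μT m)) := by
      apply fp_I.ofc
      unfold gradDot
      have := fun v => fp_pd_cont hl v
      fun_prop
    have k := ((I1.cm (2 * A τ)).sub (fp_I.const m (A τ ^ 2))).mono (I2.cm (m + 1)) (fun x _ => by
      have := fp_g1_sq (ℓ τ) x
      nlinarith [sq_nonneg (fp_g1 (ℓ τ) x - A τ)])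
    have k' : A τ ^ 2 ≤ (m + 1) * ∫ x, gradDot (ℓ τ) (ℓ τ) x ∂(μT m) := by nlinarith
    have k2 : β⁻¹ / 2 / (m + 1) * A τ ^ 2 ≤ β⁻¹ / 2 * ∫ x, gradDot (ℓ τ) (ℓ τ) x ∂(μT m) := by
      rw [div_mul_eq_mul_div, div_le_iff₀ (by positivity)]
      have : 0 < β⁻¹ / 2 := by positivity
      nlinarith
    linarith
  · intro τ hτ
    have : 0 ≤ β⁻¹ / 2 / (m + 1) * A τ ^ 2 := by positivity
    linarith
  · intro τ hτ hle
    set y := ∫ x, fp_L δ (ψ τ x) ∂(μT m) with hy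
    have P := fp_poinc (hℓ1 τ hτ) (ω := fun x => min (ψ τ x) 1)
      ((S.cont τ (hτT' τ hτ)).min continuous_const)
      (fun x => le_min (hn τ (hτT' τ hτ) x) zero_le_one) (fun x => min_le_right _ _)
      (fun x => fp_min_L hδ (hn τ (hτT' τ hτ) x))
    have hk : κ ≤ ∫ x, min (ψ τ x) 1 ∂(μT m) := hsm (Ioc_subset_Icc_self hτ)
    have r1 : 0 ≤ 2 * C / c := by positivity
    have r2 : 0 < 2 / κ := by positivity
    have r3 : 2 ≤ κ * (-y) := by
      have : 2 / κ ≤ -y := by linarith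
      rw [div_le_iff₀ hκ0] at this
      linarith
    have r4 : κ * (-y) - 1 ≤ 2 ^ (m + 1) * A τ := by
      refine le_trans ?_ P
      have : κ * (-y) ≤ (∫ x, min (ψ τ x) 1 ∂(μT m)) * (-y) :=
        mul_le_mul_of_nonneg_right hk (by linarith)
      have e : (∫ x, ℓ τ x ∂(μT m)) = y := rfl
      rw [e]
      linarith
    have r5 : κ / 2 ^ (m + 2) * (-y) ≤ A τ := by
      rw [div_mul_eq_mul_div, div_le_iff₀ (by positivity)]
      have : (2:ℝ) ^ (m + 2) = 2 * 2 ^ (m + 1) := by ring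
      rw [this]
      linarith
    have r6 : (κ / 2 ^ (m + 2)) ^ 2 * y ^ 2 ≤ A τ ^ 2 := by
      rw [← mul_pow, ← neg_sq, ← mul_neg]
      refine pow_le_pow_left₀ ?_ r5 2
      have : 0 ≤ -y := by linarith
      positivity
    have r7 : c * y ^ 2 ≤ β⁻¹ / 2 / (m + 1) * A τ ^ 2 := by
      rw [hcd, mul_assoc]
      exact mul_le_mul_of_nonneg_left r6 (by positivity)
    have r8 : C ≤ c / 2 * y ^ 2 := by
      have : 2 * C / c ≤ y ^ 2 := by nlinarith
      rw [div_le_iff₀ hc] at this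
      linarith
    linarith

def fp_S {m : ℕ} (h : ℝ → ℝ) (a x : Spc m) : ℝ := h (x.1 - a.1) + ∑ i, h (x.2 i - a.2 i)

lemma fp_c1_d {m : ℕ} {h h' : ℝ → ℝ} (hh : ∀ r, HasDerivAt h (h' r) r) (c : ℝ) (x : Spc m) :
    HasFDerivAt (fun z : Spc m => h (z.1 - c)) (h' (x.1 - c) • ContinuousLinearMap.fst ℝ ℝ (Fin m → ℝ)) x :=
  (hh (x.1 - c)).comp_hasFDerivAt x
    ((ContinuousLinearMap.fst ℝ ℝ (Fin m → ℝ)).hasFDerivAt.sub_const c)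

lemma fp_c2_d {m : ℕ} {h h' : ℝ → ℝ} (hh : ∀ r, HasDerivAt h (h' r) r) (i : Fin m) (c : ℝ) (x : Spc m) :
    HasFDerivAt (fun z : Spc m => h (z.2 i - c)) (h' (x.2 i - c) •
      ((ContinuousLinearMap.proj (R := ℝ) (φ := fun _ : Fin m => ℝ) i).comp
        (ContinuousLinearMap.snd ℝ ℝ (Fin m → ℝ)))) x :=
  (hh (x.2 i - c)).comp_hasFDerivAt x
    (((ContinuousLinearMap.proj (R := ℝ) (φ := fun _ : Fin m => ℝ) i).comp
        (ContinuousLinearMap.snd ℝ ℝ (Fin m → ℝ))).hasFDerivAt.sub_const c)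

lemma fp_S_d {m : ℕ} {h h' : ℝ → ℝ} (hh : ∀ r, HasDerivAt h (h' r) r) (a x : Spc m) :
    HasFDerivAt (fp_S h a) (h' (x.1 - a.1) • ContinuousLinearMap.fst ℝ ℝ (Fin m → ℝ)
      + ∑ i, h' (x.2 i - a.2 i) •
      ((ContinuousLinearMap.proj (R := ℝ) (φ := fun _ : Fin m => ℝ) i).comp
        (ContinuousLinearMap.snd ℝ ℝ (Fin m → ℝ)))) x :=
  (fp_c1_d hh a.1 x).add (HasFDerivAt.fun_sum fun i _ => fp_c2_d hh i (a.2 i) x)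

lemma fp_S_pd1 {m : ℕ} {h h' : ℝ → ℝ} (hh : ∀ r, HasDerivAt h (h' r) r) (a : Spc m) :
    pd (e1 m) (fp_S h a) = fun x => h' (x.1 - a.1) := by
  funext x
  unfold pd
  rw [(fp_S_d hh a x).fderiv]
  simp [e1]

lemma fp_S_pd2 {m : ℕ} {h h' : ℝ → ℝ} (hh : ∀ r, HasDerivAt h (h' r) r) (a : Spc m) (i : Fin m) :
    pd (eC m i) (fp_S h a) = fun x => h' (x.2 i - a.2 i) := by
  funext x
  unfold pd
  rw [(fp_S_d hh a x).fderiv]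
  simp [eC, Pi.single_apply]

lemma fp_S_pd11 {m : ℕ} {h h' h'' : ℝ → ℝ} (hh : ∀ r, HasDerivAt h (h' r) r)
    (hh' : ∀ r, HasDerivAt h' (h'' r) r) (a : Spc m) (x : Spc m) :
    pd (e1 m) (pd (e1 m) (fp_S h a)) x = h'' (x.1 - a.1) := by
  rw [fp_S_pd1 hh]
  unfold pd
  rw [(fp_c1_d hh' a.1 x).fderiv]
  simp [e1]

lemma fp_S_pd22 {m : ℕ} {h h' h'' : ℝ → ℝ} (hh : ∀ r, HasDerivAt h (h' r) r)
    (hh' : ∀ r, HasDerivAt h' (h'' r) r) (a : Spc m) (i : Fin m) (x : Spc m) :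
    pd (eC m i) (pd (eC m i) (fp_S h a)) x = h'' (x.2 i - a.2 i) := by
  rw [fp_S_pd2 hh]
  unfold pd
  rw [(fp_c2_d hh' i (a.2 i) x).fderiv]
  simp [eC]

def fp_q (r : ℝ) : ℝ := (1 - Real.cos (2 * Real.pi * r)) / (2 * Real.pi ^ 2)
def fp_q' (r : ℝ) : ℝ := Real.sin (2 * Real.pi * r) / Real.pi
def fp_q'' (r : ℝ) : ℝ := 2 * Real.cos (2 * Real.pi * r)

lemma fp_q_d (r : ℝ) : HasDerivAt fp_q (fp_q' r) r := by
  have := ((((hasDerivAt_id r).const_mul (2 * Real.pi)).cos).const_sub 1).div_const (2 * Real.pi ^ 2)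
  refine this.congr_deriv ?_
  unfold fp_q'
  have := Real.pi_pos
  simp only [id]
  field_simp

lemma fp_q'_d (r : ℝ) : HasDerivAt fp_q' (fp_q'' r) r := by
  have := (((hasDerivAt_id r).const_mul (2 * Real.pi)).sin).div_const Real.pi
  refine this.congr_deriv ?_
  unfold fp_q''
  have := Real.pi_pos
  simp only [id]
  field_simp

lemma fp_q_nn (r : ℝ) : 0 ≤ fp_q r :=
  div_nonneg (by linarith [Real.cos_le_one (2 * Real.pi * r)]) (by positivity)

lemma fp_q_le (r : ℝ) : fp_q r ≤ r ^ 2 := by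
  unfold fp_q
  rw [div_le_iff₀ (by positivity)]
  have := Real.one_sub_sq_div_two_le_cos (x := 2 * Real.pi * r)
  nlinarith

lemma fp_q'_sq (r : ℝ) : fp_q' r ^ 2 = 4 * fp_q r * (1 - Real.pi ^ 2 * fp_q r) := by
  have h := Real.sin_sq_add_cos_sq (2 * Real.pi * r)
  have hp := Real.pi_pos
  unfold fp_q' fp_q
  rw [div_pow, show Real.sin (2 * Real.pi * r) ^ 2 = 1 - Real.cos (2 * Real.pi * r) ^ 2 by linarith]
  field_simp
  ring

lemma fp_q''_eq (r : ℝ) : fp_q'' r = 2 - 4 * Real.pi ^ 2 * fp_q r := by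
  have hp := Real.pi_pos
  unfold fp_q'' fp_q
  field_simp
  ring

lemma fp_q_per (r : ℝ) (k : ℤ) : fp_q (r + k) = fp_q r := by
  unfold fp_q
  rw [show 2 * Real.pi * (r + k) = 2 * Real.pi * r + k * (2 * Real.pi) by ring,
    Real.cos_add_int_mul_two_pi]

lemma fp_q_cd : ContDiff ℝ 2 fp_q := by
  unfold fp_q
  fun_prop

def fp_Q {m : ℕ} (a x : Spc m) : ℝ := fp_S fp_q a x

lemma fp_Q_nn {m : ℕ} (a x : Spc m) : 0 ≤ fp_Q a x :=
  add_nonneg (fp_q_nn _) (Finset.sum_nonneg fun _ _ => fp_q_nn _)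

lemma fp_Q_per {m : ℕ} (a : Spc m) : IsPeriodic (fp_Q a) := by
  intro x k j
  unfold fp_Q fp_S
  simp only [add_sub_right_comm, fp_q_per]

lemma fp_Q_cd {m : ℕ} (a : Spc m) : ContDiff ℝ 2 (fp_Q a) := by
  unfold fp_Q fp_S
  have := fp_q_cd
  refine (this.comp (by fun_prop)).add (ContDiff.sum fun i _ => this.comp (by fun_prop))

/-- approximate backward heat kernel -/
def fp_K {m : ℕ} (D T : ℝ) (a : Spc m) (τ : ℝ) (x : Spc m) : ℝ :=
  Real.exp (-((m + 1) * D * Real.pi ^ 2) * τ - (m + 1) / 2 * Real.log (T - τ)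
    - fp_Q a x * (4 * D * (T - τ))⁻¹)

def fp_Kt {m : ℕ} (D T : ℝ) (a : Spc m) (τ : ℝ) (x : Spc m) : ℝ :=
  fp_K D T a τ x * (-((m + 1) * D * Real.pi ^ 2) + (m + 1) / 2 * (T - τ)⁻¹
    - fp_Q a x * (4 * D * (T - τ) ^ 2)⁻¹)

lemma fp_K_pos {m : ℕ} (D T : ℝ) (a : Spc m) (τ : ℝ) (x : Spc m) : 0 < fp_K D T a τ x :=
  Real.exp_pos _

lemma fp_K_dt {m : ℕ} {D T : ℝ} (hD : 0 < D) (a : Spc m) {τ : ℝ} (hτ : τ < T) (x : Spc m) :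
    HasDerivAt (fun s => fp_K D T a s x) (fp_Kt D T a τ x) τ := by
  have hs : 0 < T - τ := by linarith
  have h1 : HasDerivAt (fun s => T - s) (-1) τ := by simpa using (hasDerivAt_id τ).const_sub T
  have h2 := h1.log hs.ne'
  have h3 := (h1.const_mul (4 * D)).inv (by positivity)
  have h4 := ((((hasDerivAt_id τ).const_mul (-((m + 1) * D * Real.pi ^ 2))).sub
    (h2.const_mul ((m + 1) / 2 : ℝ))).sub (h3.const_mul (fp_Q a x))).exp
  refine h4.congr_deriv ?_
  unfold fp_Kt fp_K
  simp only [id]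
  congr 1
  field_simp
  ring

lemma fp_K_cd {m : ℕ} (D T : ℝ) (a : Spc m) (τ : ℝ) : ContDiff ℝ 2 (fp_K D T a τ) := by
  have := fp_Q_cd a
  unfold fp_K
  fun_prop

lemma fp_K_per {m : ℕ} (D T : ℝ) (a : Spc m) (τ : ℝ) : IsPeriodic (fp_K D T a τ) := by
  intro x k j
  unfold fp_K
  rw [fp_Q_per a x k j]

lemma fp_Ker_K {m : ℕ} {D T : ℝ} (hD : 0 < D) (c : Spc m) {a b : ℝ} (hb : b < T) :
    fp_Ker a b (fp_K D T c) (fp_Kt D T c) := by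
  have hQ := (fp_Q_cd c).continuous
  have hne : ∀ z ∈ Icc a b ×ˢ Icc (0 : Spc m) 1, T - z.1 ≠ 0 := fun z hz => by
    have := hz.1.2
    intro h
    linarith
  have hne2 : ∀ z ∈ Icc a b ×ˢ Icc (0 : Spc m) 1, 4 * D * (T - z.1) ≠ 0 := fun z hz =>
    mul_ne_zero (by positivity) (hne z hz)
  have hne3 : ∀ z ∈ Icc a b ×ˢ Icc (0 : Spc m) 1, 4 * D * (T - z.1) ^ 2 ≠ 0 := fun z hz =>
    mul_ne_zero (by positivity) (pow_ne_zero _ (hne z hz))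
  have j1 : ContinuousOn (fun z : ℝ × Spc m => fp_K D T c z.1 z.2) (Icc a b ×ˢ Icc 0 1) := by
    unfold fp_K
    refine Real.continuous_exp.comp_continuousOn ?_
    refine ContinuousOn.sub (ContinuousOn.sub (by fun_prop) (continuousOn_const.mul
      (ContinuousOn.log (by fun_prop) hne))) (ContinuousOn.mul (by fun_prop) (ContinuousOn.inv₀ (by fun_prop) hne2))
  have j2 : ∀ τ, Continuous (fp_K D T c τ) := fun τ => (fp_K_cd D T c τ).continuous
  refine ⟨fun τ hτ x => fp_K_dt hD c (hτ.2.trans_lt hb) x, j1, ?_, fun τ _ => j2 τ, fun τ _ => ?_,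
    fun τ _ x => (fp_K_pos _ _ _ _ _).le⟩
  · unfold fp_Kt
    refine j1.mul ?_
    refine ContinuousOn.sub (continuousOn_const.add (continuousOn_const.mul
      (ContinuousOn.inv₀ (by fun_prop) hne))) (ContinuousOn.mul (by fun_prop) (ContinuousOn.inv₀ (by fun_prop) hne3))
  · unfold fp_Kt
    have := j2 τ
    fun_prop

lemma fp_K_pd {m : ℕ} (D T : ℝ) (a : Spc m) (τ : ℝ) (v : Spc m) :
    pd v (fp_K D T a τ) = fun x => -(4 * D * (T - τ))⁻¹ * (fp_K D T a τ x * pd v (fp_Q a) x) := by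
  funext x
  set A := -((m + 1) * D * Real.pi ^ 2) * τ - (m + 1) / 2 * Real.log (T - τ)
  set B := (4 * D * (T - τ))⁻¹
  have hΦ : ∀ r, HasDerivAt (fun r => Real.exp (A - r * B)) (-B * Real.exp (A - r * B)) r := fun r => by
    have := (((hasDerivAt_id r).mul_const B).const_sub A).exp
    refine this.congr_deriv ?_
    simp only [id]
    ring
  have := fp_pd_comp v (Φ := fun r => Real.exp (A - r * B)) (Φ' := fun r => -B * Real.exp (A - r * B))
    x (hΦ _) ((fp_Q_cd a).differentiable (by norm_num))
  rw [← mul_assoc]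
  exact this

lemma fp_K_pd2 {m : ℕ} (D T : ℝ) (a : Spc m) (τ : ℝ) (v : Spc m) (x : Spc m) :
    pd v (pd v (fp_K D T a τ)) x = fp_K D T a τ x *
      ((4 * D * (T - τ))⁻¹ ^ 2 * pd v (fp_Q a) x ^ 2 - (4 * D * (T - τ))⁻¹ * pd v (pd v (fp_Q a)) x) := by
  have d1 := (fp_K_cd D T a τ).differentiable (by norm_num)
  have d2 := (fp_pd_C1 (fp_Q_cd a) v).differentiable (by norm_num)
  rw [fp_K_pd, fp_pd_const_mul v _ (g := fun x => fp_K D T a τ x * pd v (fp_Q a) x) (d1.mul d2), fp_pd_mul v d1 d2, fp_K_pd]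
  ring

lemma fp_K_lap {m : ℕ} (D T : ℝ) (a : Spc m) (τ : ℝ) (x : Spc m) :
    lap (fp_K D T a τ) x = fp_K D T a τ x *
      fp_S (fun r => (4 * D * (T - τ))⁻¹ ^ 2 * fp_q' r ^ 2 - (4 * D * (T - τ))⁻¹ * fp_q'' r) a x := by
  have e : fp_Q a = fp_S fp_q a := rfl
  unfold lap
  simp only [fp_K_pd2]
  rw [e, fp_S_pd11 fp_q_d fp_q'_d]
  simp only [fp_S_pd22 fp_q_d fp_q'_d]
  rw [fp_S_pd1 fp_q_d]
  simp only [fp_S_pd2 fp_q_d]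
  rw [← Finset.mul_sum, ← mul_add]
  rfl

lemma fp_S_lin {m : ℕ} {f g : ℝ → ℝ} (h : ∀ r, f r ≤ g r) (a x : Spc m) : fp_S f a x ≤ fp_S g a x :=
  add_le_add (h _) (Finset.sum_le_sum fun _ _ => h _)

lemma fp_S_comb {m : ℕ} (f g : ℝ → ℝ) (k l p : ℝ) (a x : Spc m) :
    fp_S (fun r => k * f r + l * g r + p) a x = k * fp_S f a x + l * fp_S g a x + (m + 1) * p := by
  unfold fp_S
  simp only [Finset.sum_add_distrib, ← Finset.mul_sum, Finset.sum_const, Finset.card_univ,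
    Fintype.card_fin, nsmul_eq_mul]
  ring

lemma fp_K_sub {m : ℕ} {D T : ℝ} (hD : 0 < D) (a : Spc m) {τ : ℝ} (hτ : τ < T) (x : Spc m) :
    fp_Kt D T a τ x + D * lap (fp_K D T a τ) x ≤ 0 := by
  have hs : 0 < T - τ := by linarith
  set s := T - τ with hsd
  rw [fp_K_lap, fp_Kt, ← hsd]
  have hG := fp_K_pos D T a τ x
  have key : fp_S (fun r => (4 * D * s)⁻¹ ^ 2 * fp_q' r ^ 2 - (4 * D * s)⁻¹ * fp_q'' r) a x
      ≤ (4 * D ^ 2 * s ^ 2)⁻¹ * fp_S fp_q a x + 0 * fp_S fp_q a x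
        + (m + 1) * (Real.pi ^ 2 - (2 * D * s)⁻¹) := by
    rw [← fp_S_comb]
    refine fp_S_lin (fun r => ?_) a x
    rw [fp_q'_sq, fp_q''_eq]
    have : (4 * D ^ 2 * s ^ 2)⁻¹ * fp_q r + 0 * fp_q r + (Real.pi ^ 2 - (2 * D * s)⁻¹)
      - ((4 * D * s)⁻¹ ^ 2 * (4 * fp_q r * (1 - Real.pi ^ 2 * fp_q r))
        - (4 * D * s)⁻¹ * (2 - 4 * Real.pi ^ 2 * fp_q r))
      = Real.pi ^ 2 * (fp_q r * (2 * D * s)⁻¹ - 1) ^ 2 := by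
      field_simp
      ring
    have h2 : 0 ≤ Real.pi ^ 2 * (fp_q r * (2 * D * s)⁻¹ - 1) ^ 2 := by positivity
    linarith
  have k2 := mul_le_mul_of_nonneg_left key hD.le
  have e : D * ((4 * D ^ 2 * s ^ 2)⁻¹ * fp_S fp_q a x + 0 * fp_S fp_q a x
        + (m + 1) * (Real.pi ^ 2 - (2 * D * s)⁻¹)) = fp_Q a x * (4 * D * s ^ 2)⁻¹
        + (m + 1) * D * Real.pi ^ 2 - (m + 1) / 2 * s⁻¹ := by
    unfold fp_Q
    field_simp
    ring
  rw [e] at k2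
  have k3 := mul_le_mul_of_nonneg_left k2 hG.le
  nlinarith

lemma fp_K_g1 {m : ℕ} {D T : ℝ} (hD : 0 < D) (a : Spc m) {τ : ℝ} (hτ : τ < T) (x : Spc m) :
    fp_g1 (fp_K D T a τ) x ≤ Real.sqrt (T - τ) / 2 * lap (fp_K D T a τ) x
      + (m + 1) * (1 / 2 + 1 / (4 * D)) * (Real.sqrt (T - τ))⁻¹ * fp_K D T a τ x := by
  have hs : 0 < T - τ := by linarith
  have hG := fp_K_pos D T a τ x
  have e0 : fp_Q a = fp_S fp_q a := rfl
  have e : fp_g1 (fp_K D T a τ) x = fp_K D T a τ x * fp_S (fun r => (4 * D * (T - τ))⁻¹ * |fp_q' r|) a x := by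
    unfold fp_g1
    simp only [fp_K_pd]
    rw [e0, fp_S_pd1 fp_q_d]
    simp only [fp_S_pd2 fp_q_d]
    have hb : 0 < (4 * D * (T - τ))⁻¹ := by positivity
    simp only [abs_mul, abs_neg, abs_of_pos hb, abs_of_pos hG]
    unfold fp_S
    rw [mul_add, Finset.mul_sum]
    congr 1
    · ring
    · exact Finset.sum_congr rfl fun _ _ => by ring
  rw [e, fp_K_lap]
  set w := Real.sqrt (T - τ) with hw
  have hw0 : 0 < w := Real.sqrt_pos.2 hs
  have hs2 : T - τ = w ^ 2 := (Real.sq_sqrt hs.le).symm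
  rw [hs2]
  set F := fun r => (4 * D * w ^ 2)⁻¹ ^ 2 * fp_q' r ^ 2 - (4 * D * w ^ 2)⁻¹ * fp_q'' r with hF
  have key : fp_S (fun r => (4 * D * w ^ 2)⁻¹ * |fp_q' r|) a x
      ≤ w / 2 * fp_S F a x + 0 * fp_S F a x + (m + 1) * ((1 / 2 + 1 / (4 * D)) * w⁻¹) := by
    rw [← fp_S_comb]
    refine fp_S_lin (fun r => ?_) a x
    have h1 : fp_q'' r ≤ 2 := by
      unfold fp_q''
      linarith [Real.cos_le_one (2 * Real.pi * r)]
    have h2 : 0 ≤ w / 2 * (4 * D * w ^ 2)⁻¹ * (2 - fp_q'' r) :=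
      mul_nonneg (by positivity) (by linarith)
    have h3 : 0 ≤ w / 2 * ((4 * D * w ^ 2)⁻¹ * |fp_q' r| - w⁻¹) ^ 2 := by positivity
    have h4 : w / 2 * F r + 0 * F r + (1 / 2 + 1 / (4 * D)) * w⁻¹ - (4 * D * w ^ 2)⁻¹ * |fp_q' r|
      = w / 2 * ((4 * D * w ^ 2)⁻¹ * |fp_q' r| - w⁻¹) ^ 2 + w / 2 * (4 * D * w ^ 2)⁻¹ * (2 - fp_q'' r) := by
      have : fp_q' r ^ 2 = |fp_q' r| ^ 2 := (sq_abs _).symm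
      rw [hF]
      simp only [this]
      field_simp
      ring
    linarith
  have k3 := mul_le_mul_of_nonneg_left key hG.le
  refine k3.trans (le_of_eq ?_)
  ring

lemma fp_lap_int {m : ℕ} {G : Spc m → ℝ} (hG : ContDiff ℝ 2 G) (hp : IsPeriodic G) :
    fp_I (fun x => lap G x) 0 := by
  have hc := fp_lap_cont hG
  refine ⟨fp_int hc, ?_⟩
  exact fp_div (pd (e1 m) G) (fun i => pd (eC m i) G) (fp_per_pd hp _) (fun i => fp_per_pd hp _)
    ((fp_pd_C1 hG _).differentiable (by norm_num))
    (fun i => (fp_pd_C1 hG _).differentiable (by norm_num)) (fp_int hc)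

lemma fp_phi_one : fp_Phi (fun _ => -1) (fun _ => 0) 1 0 where
  cont := continuousOn_const
  cont' := continuousOn_const
  K0 := zero_le_one
  L0 := le_rfl
  bd := fun _ _ => by simp
  bd' := fun _ _ => by simp
  lip := fun _ _ _ _ => by simp
  sg := fun _ _ _ _ => by simp

lemma fp_main {m : ℕ} {V : Spc m → ℝ} {β T M : ℝ} {ψ : ℝ → Spc m → ℝ} (hβ : 0 < β)
    (hV : ContDiff ℝ 2 V) (hVp : IsPeriodic V) (S : fp_Sol V β T ψ)
    (hn : ∀ t ∈ Icc 0 T, ∀ x, 0 ≤ ψ t x) (hM1 : ∀ x, |pd (e1 m) V x| ≤ M)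
    (hM2 : ∀ i x, |pd (eC m i) V x| ≤ M) (hT : 0 < T) :
    ∃ K, ∀ (c : Spc m) (η δ : ℝ), 0 < η → η ≤ 1 → 0 < δ →
      -K ≤ ∫ x, fp_K β⁻¹ (T + η) c T x * fp_L δ (ψ T x) ∂(μT m) := by
  obtain ⟨K0, hK0, HK⟩ := fp_H hβ hV hVp S hn hM1 hM2 (a := T / 2) (b := 3 * T / 4)
    (by linarith) (by linarith) (by linarith)
  have hM : 0 ≤ M := (abs_nonneg _).trans (hM1 0)
  have hD : 0 < β⁻¹ := by positivity
  set D := β⁻¹ with hDd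
  set b := 3 * T / 4 with hbd
  have hb0 : 0 < b := by positivity
  have hbT : b < T := by rw [hbd]; linarith
  set B := Real.exp (-((m + 1) / 2 * Real.log (T - b))) with hB
  have hB0 : 0 < B := Real.exp_pos _
  set C := β * ((m + 2) * M ^ 2) with hC
  have hC0 : 0 ≤ C := by positivity
  set C3 := ((m:ℝ) + 1) * (1 / 2 + 1 / (4 * D)) with hC3
  have hC30 : 0 ≤ C3 := by positivity
  refine ⟨B * K0 + C * B * T + 4 * M * C3 * B * Real.sqrt (T + 1), fun c η δ hη hη1 hδ => ?_⟩
  set G := fp_K D (T + η) c with hG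
  have hlt : ∀ τ ∈ Icc b T, τ < T + η := fun τ hτ => by linarith [hτ.2]
  have R := fp_Ker_K (D := D) hD c (a := b) (b := T) (T := T + η) (by linarith)
  have hτT : ∀ τ ∈ Icc b T, τ ∈ Icc 0 T := fun τ hτ => ⟨hb0.le.trans hτ.1, hτ.2⟩
  have hτT' : ∀ τ ∈ Icc b T, τ ∈ Ioc 0 T := fun τ hτ => ⟨hb0.trans_le hτ.1, hτ.2⟩
  have cG : ∀ τ, Continuous (G τ) := fun τ => (fp_K_cd _ _ _ _).continuous
  have clG : ∀ τ, Continuous (lap (G τ)) := fun τ => fp_lap_cont (fp_K_cd _ _ _ _)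
  have cℓ : ∀ τ ∈ Icc b T, Continuous (fun x => fp_L δ (ψ τ x)) := fun τ hτ =>
    (fp_L_C1 hδ (fp_C1 (S.diff τ (hτT' τ hτ)) (S.diff2 τ (hτT' τ hτ))) (hn τ (hτT τ hτ))).continuous
  have hℓ0 : ∀ τ ∈ Icc b T, ∀ x, fp_L δ (ψ τ x) ≤ 0 := fun τ hτ x => fp_L_np hδ (hn τ (hτT τ hτ) x)
  have hGB : ∀ x, G b x ≤ B := fun x => by
    rw [hG, hB]
    unfold fp_K
    refine Real.exp_le_exp.2 ?_
    have l1 : Real.log (T - b) ≤ Real.log (T + η - b) := Real.log_le_log (by linarith) (by linarith)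
    have l2 : 0 ≤ fp_Q c x * (4 * D * (T + η - b))⁻¹ :=
      mul_nonneg (fp_Q_nn c x) (inv_nonneg.2 (mul_nonneg (by positivity) (by linarith)))
    have l3 : 0 ≤ ((m + 1) * D * Real.pi ^ 2) * b := by positivity
    have l4 : (m + 1 : ℝ) / 2 * Real.log (T - b) ≤ (m + 1) / 2 * Real.log (T + η - b) :=
      mul_le_mul_of_nonneg_left l1 (by positivity)
    linarith
  have bI : b ∈ Icc b T := ⟨le_rfl, hbT.le⟩
  -- mass
  have hN : ∀ τ ∈ Icc b T, ∫ x, G τ x ∂(μT m) ≤ B := by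
    intro τ hτ
    have Nb : ∫ x, G b x ∂(μT m) ≤ B := by
      exact (fp_I.ofc (cG b)).mono (fp_I.const m B) fun x _ => hGB x
    have Yc := (fp_Y_cont S hn fp_phi_one hb0.le le_rfl R).mono (Icc_subset_Icc_right hτ.2)
    have := fp_mono hτ.1 Yc (fun s hs => ?_)
    · simp only [mul_neg, mul_one, integral_neg] at this
      linarith
    · have hs' : s ∈ Icc b T := ⟨hs.1.le, hs.2.trans hτ.2⟩
      refine fp_LD_mono (fp_Y_dini S hn fp_phi_one hb0.le le_rfl R ⟨hs.1, hs.2.trans hτ.2⟩) ?_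
      simp only [mul_zero, zero_mul, integral_zero, add_zero]
      have I1 := (fp_lap_int (fp_K_cd D (T + η) c s) (fp_K_per D (T + η) c s)).cm D
      rw [mul_zero] at I1
      refine I1.mono (fp_I.ofc ((R.ct s hs').mul continuous_const)) fun x _ => ?_
      have := fp_K_sub hD c (hlt s hs') x
      linarith
  -- gradient
  have hg1 : ∀ τ ∈ Icc b T, ∫ x, fp_g1 (G τ) x ∂(μT m) ≤ C3 * B * (Real.sqrt (T + η - τ))⁻¹ := by
    intro τ hτ
    have I1 := ((fp_lap_int (fp_K_cd D (T + η) c τ) (fp_K_per D (T + η) c τ)).cm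
      (Real.sqrt (T + η - τ) / 2)).add ((fp_I.ofc (cG τ)).cm (C3 * (Real.sqrt (T + η - τ))⁻¹))
    have := (fp_I.ofc (fp_g1_cont ((fp_K_cd D (T + η) c τ).of_le (by norm_num)))).mono I1
      (fun x _ => fp_K_g1 hD c (hlt τ hτ) x)
    refine this.trans ?_
    have h1 : 0 ≤ C3 * (Real.sqrt (T + η - τ))⁻¹ := by positivity
    have := mul_le_mul_of_nonneg_left (hN τ hτ) h1
    linarith
  have Yc := fp_Y_cont S hn (fp_L_phi hδ) hb0.le le_rfl R
  have hmain := fp_mono' (f := fun τ => ∫ x, G τ x * fp_L δ (ψ τ x) ∂(μT m))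
    (H := fun τ => -(C * B) * τ + 4 * M * C3 * B * Real.sqrt (T + η - τ))
    (g := fun τ => -(C * B) - 2 * M * C3 * B * (Real.sqrt (T + η - τ))⁻¹) hbT.le Yc ?_ ?_ ?_
  · have hYb : -(B * K0) ≤ ∫ x, G b x * fp_L δ (ψ b x) ∂(μT m) := by
      have := ((fp_I.ofc (cℓ b bI)).cm B).mono
        (fp_I.ofc (f := fun x => G b x * fp_L δ (ψ b x)) ((cG b).mul (cℓ b bI)))
        (fun x _ => mul_le_mul_of_nonpos_right (hGB x) (hℓ0 b bI x))
      have h2 := mul_le_mul_of_nonneg_left (HK δ hδ) hB0.le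
      linarith
    have h3 : Real.sqrt (T + η - b) ≤ Real.sqrt (T + 1) := Real.sqrt_le_sqrt (by linarith)
    have h4 : 0 ≤ 4 * M * C3 * B := by positivity
    have h5 := mul_le_mul_of_nonneg_left h3 h4
    have h6 : 0 ≤ 4 * M * C3 * B * Real.sqrt (T + η - T) := by positivity
    have h7 : 0 ≤ C * B * b := by positivity
    linarith
  · intro τ hτ
    have hτ' : τ ∈ Icc b T := ⟨hτ.1.le, hτ.2⟩
    refine fp_LD_mono (fp_Y_dini S hn (fp_L_phi hδ) hb0.le le_rfl R hτ) ?_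
    have E := fp_energy (G := G τ) hβ hV hVp (S.per τ (hτT' τ hτ')) (S.diff τ (hτT' τ hτ'))
      (S.diff2 τ (hτT' τ hτ')) (S.marg τ (hτT' τ hτ')) (hn τ (hτT τ hτ')) (S.intv τ (hτT' τ hτ'))
      hM1 hM2 hδ (fp_K_cd D (T + η) c τ) (fp_K_per D (T + η) c τ) (fun x => (fp_K_pos _ _ _ _ x).le)
    have E2 : 0 ≤ ∫ x, G τ x * gradDot (fun z => fp_L δ (ψ τ z)) (fun z => fp_L δ (ψ τ z)) x ∂(μT m) :=
      integral_nonneg fun x => mul_nonneg (fp_K_pos _ _ _ _ x).le (fp_gradDot_nn _ x)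
    have J1 := fp_I.ofc (f := fun x => fp_Kt D (T + η) c τ x * fp_L δ (ψ τ x)) ((R.ct τ hτ').mul (cℓ τ hτ'))
    have J2 := fp_I.ofc (f := fun x => lap (G τ) x * fp_L δ (ψ τ x)) ((clG τ).mul (cℓ τ hτ'))
    have E3 := (fp_I.const m 0).mono (J1.add (J2.cm D)) (fun x _ => by
      have h1 := fp_K_sub hD c (hlt τ hτ') x
      have h2 := hℓ0 τ hτ' x
      have := mul_nonneg_of_nonpos_of_nonpos h1 h2
      linarith)
    have E4 := mul_le_mul_of_nonneg_left (hN τ hτ') hC0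
    have E5 := mul_le_mul_of_nonneg_left (hg1 τ hτ') (show 0 ≤ 2 * M by positivity)
    have E6 := mul_nonneg (show 0 ≤ D / 2 by positivity) E2
    linarith
  · fun_prop
  · intro τ hτ
    have hs : 0 < T + η - τ := by linarith [hτ.2]
    have h1 : HasDerivAt (fun s => T + η - s) (-1) τ := by simpa using (hasDerivAt_id τ).const_sub (T + η)
    have := ((hasDerivAt_id τ).const_mul (-(C * B))).add
      ((h1.sqrt hs.ne').const_mul (4 * M * C3 * B))
    refine this.congr_deriv ?_
    have : 0 < Real.sqrt (T + η - τ) := Real.sqrt_pos.2 hs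
    field_simp
    ring

lemma fp_box_vol {m : ℕ} (a : Spc m) {r : ℝ} (hr : 0 < r) :
    volume ((Ico a.1 (a.1 + r)) ×ˢ (Set.pi univ fun i => Ico (a.2 i) (a.2 i + r)) : Set (Spc m))
      = ENNReal.ofReal (r ^ (m + 1)) := by
  rw [Measure.volume_eq_prod, Measure.prod_prod, volume_pi_pi]
  simp only [Real.volume_Ico, add_sub_cancel_left, Finset.prod_const, Finset.card_univ,
    Fintype.card_fin]
  rw [pow_succ', ENNReal.ofReal_mul hr.le, ENNReal.ofReal_pow hr.le]

lemma fp_pos {m : ℕ} {V : Spc m → ℝ} {β T M : ℝ} {ψ : ℝ → Spc m → ℝ} (hβ : 0 < β)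
    (hV : ContDiff ℝ 2 V) (hVp : IsPeriodic V) (S : fp_Sol V β T ψ)
    (hn : ∀ t ∈ Icc 0 T, ∀ x, 0 ≤ ψ t x) (hM1 : ∀ x, |pd (e1 m) V x| ≤ M)
    (hM2 : ∀ i x, |pd (eC m i) V x| ≤ M) (hT : 0 < T) {a : Spc m} (ha : a ∈ cube m) :
    0 < ψ T a := by
  have hTm : T ∈ Icc 0 T := ⟨hT.le, le_rfl⟩
  have hTm' : T ∈ Ioc 0 T := ⟨hT, le_rfl⟩
  refine lt_of_le_of_ne (hn T hTm a) fun h0 => ?_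
  obtain ⟨K, hK⟩ := fp_main hβ hV hVp S hn hM1 hM2 hT
  set D := β⁻¹ with hDd
  have hD : 0 < D := by positivity
  set c0 := Real.exp (-((m + 1) * D * Real.pi ^ 2) * T - (m + 1) / (4 * D)) with hc0
  have hc00 : 0 < c0 := Real.exp_pos _
  set ε := (2 * Real.exp (K / c0))⁻¹ with hε
  have hε0 : 0 < ε := by positivity
  have hLε : c0 * fp_L ε ε < -K := by
    have e : ε + ε = (Real.exp (K / c0))⁻¹ := by rw [hε, mul_inv]; ring
    have h1 : fp_L ε ε < -(K / c0) := by
      unfold fp_L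
      rw [e, Real.log_inv, Real.log_exp]
      have : 0 < Real.log ((Real.exp (K / c0))⁻¹ + 1) := Real.log_pos (by
        have : 0 < (Real.exp (K / c0))⁻¹ := by positivity
        linarith)
      linarith
    have h2 := mul_lt_mul_of_pos_left h1 hc00
    have h3 : c0 * -(K / c0) = -K := by field_simp
    linarith
  have hc := S.cont T hTm
  have hU : {x : Spc m | ψ T x < ε ∧ x.1 < 1 ∧ ∀ i, x.2 i < 1} ∈ nhds a := by
    refine IsOpen.mem_nhds ?_ ⟨by rw [← h0]; exact hε0, ha.1.2, fun i => (ha.2 i (mem_univ _)).2⟩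
    refine (isOpen_lt hc continuous_const).inter ((isOpen_lt continuous_fst continuous_const).inter ?_)
    have hi : {x : Spc m | ∀ i, x.2 i < 1} = ⋂ i, {x : Spc m | x.2 i < 1} := by
      ext x
      simp
    refine (show IsOpen {x : Spc m | ∀ i, x.2 i < 1} from ?_)
    rw [hi]
    exact isOpen_iInter_of_finite fun i => isOpen_lt (by fun_prop) continuous_const
  obtain ⟨ρ, hρ, hball⟩ := Metric.mem_nhds_iff.1 hU
  set r := min (ρ / 2) 1 with hr
  have hr0 : 0 < r := lt_min (by positivity) one_pos
  have hr1 : r ≤ 1 := min_le_right _ _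
  have hrρ : r < ρ := (min_le_left _ _).trans_lt (by linarith)
  set box : Set (Spc m) := (Ico a.1 (a.1 + r)) ×ˢ (Set.pi univ fun i => Ico (a.2 i) (a.2 i + r)) with hbox
  have hbU : ∀ x ∈ box, ψ T x < ε ∧ x.1 < 1 ∧ ∀ i, x.2 i < 1 := by
    intro x hx
    apply hball
    rw [Metric.mem_ball, Prod.dist_eq]
    refine lt_of_le_of_lt (max_le ?_ ?_) hrρ
    · rw [Real.dist_eq, abs_le]
      exact ⟨by linarith [hx.1.1], by linarith [hx.1.2]⟩
    · refine (dist_pi_le_iff hr0.le).2 fun i => ?_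
      have := hx.2 i (mem_univ _)
      rw [Real.dist_eq, abs_le]
      exact ⟨by linarith [this.1], by linarith [this.2]⟩
  have hbc : box ⊆ cube m := fun x hx => by
    have h1 := hbU x hx
    refine ⟨⟨ha.1.1.trans hx.1.1, h1.2.1⟩, fun i _ => ⟨?_, h1.2.2 i⟩⟩
    exact (ha.2 i (mem_univ _)).1.trans (hx.2 i (mem_univ _)).1
  have hbm : MeasurableSet box := measurableSet_Ico.prod (MeasurableSet.univ_pi fun _ => measurableSet_Ico)
  have hmu : (μT m).real box = r ^ (m + 1) := by
    rw [Measure.real, μT, Measure.restrict_apply hbm, inter_eq_left.2 hbc, fp_box_vol a hr0,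
      ENNReal.toReal_ofReal (by positivity)]
  have hGl : ∀ x ∈ box, c0 * (r ^ (m + 1))⁻¹ ≤ fp_K D (T + r ^ 2) a T x := by
    intro x hx
    have hQ : fp_Q a x ≤ (m + 1) * r ^ 2 := by
      have h1 : ∀ s, 0 ≤ s → s ≤ r → fp_q s ≤ r ^ 2 := fun s h1 h2 =>
        (fp_q_le s).trans (pow_le_pow_left₀ h1 h2 2)
      have h2 : ∑ i, fp_q (x.2 i - a.2 i) ≤ ∑ _i : Fin m, r ^ 2 := Finset.sum_le_sum fun i _ => by
        have := hx.2 i (mem_univ _)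
        exact h1 _ (by linarith [this.1]) (by linarith [this.2])
      have h3 := h1 (x.1 - a.1) (by linarith [hx.1.1]) (by linarith [hx.1.2])
      simp only [Finset.sum_const, Finset.card_univ, Fintype.card_fin, nsmul_eq_mul] at h2
      unfold fp_Q fp_S
      linarith
    have e1 : (r ^ (m + 1))⁻¹ = Real.exp (-((m + 1) / 2 * Real.log (r ^ 2))) := by
      rw [Real.exp_neg, Real.log_pow]
      congr 1
      rw [show ((m:ℝ) + 1) / 2 * (((2:ℕ):ℝ) * Real.log r) = ((m + 1 : ℕ) : ℝ) * Real.log r by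
        push_cast; ring, Real.exp_nat_mul, Real.exp_log hr0]
    rw [e1, hc0, ← Real.exp_add]
    unfold fp_K
    rw [add_sub_cancel_left]
    refine Real.exp_le_exp.2 ?_
    have h4 : fp_Q a x * (4 * D * r ^ 2)⁻¹ ≤ (m + 1) / (4 * D) := by
      refine (mul_le_mul_of_nonneg_right hQ (by positivity)).trans (le_of_eq ?_)
      field_simp
    linarith
  have hfin := hK a (r ^ 2) ε (by positivity) (pow_le_one₀ hr0.le hr1) hε0
  have cℓ : Continuous (fun x => fp_L ε (ψ T x)) :=
    (fp_L_C1 hε0 (fp_C1 (S.diff T hTm') (S.diff2 T hTm')) (hn T hTm)).continuous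
  have hup : ∫ x, fp_K D (T + r ^ 2) a T x * fp_L ε (ψ T x) ∂(μT m)
      ≤ ∫ x, box.indicator (fun _ => c0 * (r ^ (m + 1))⁻¹ * fp_L ε ε) x ∂(μT m) := by
    refine fp_mono_cube (fp_int ((fp_K_cd _ _ _ _).continuous.mul cℓ))
      ((integrable_const _).indicator hbm) fun x _ => ?_
    have hK0 := (fp_K_pos D (T + r ^ 2) a T x).le
    by_cases hx : x ∈ box
    · rw [indicator_of_mem hx]
      have h1 := hGl x hx
      have h2 := fp_L_anti hε0 (hn T hTm x) (hbU x hx).1.le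
      have h3 : fp_L ε ε ≤ 0 := fp_L_np hε0 hε0.le
      exact (mul_le_mul_of_nonneg_left h2 hK0).trans (mul_le_mul_of_nonpos_right h1 h3)
    · rw [indicator_of_notMem hx]
      exact mul_nonpos_of_nonneg_of_nonpos hK0 (fp_L_np hε0 (hn T hTm x))
  rw [integral_indicator_const _ hbm, hmu, smul_eq_mul] at hup
  have e : r ^ (m + 1) * (c0 * (r ^ (m + 1))⁻¹ * fp_L ε ε) = c0 * fp_L ε ε := by
    field_simp
  linarith

/-- **Positivity (Proposition `pos1`).** Assume `[H₁]` and `[H₂]`. Then the `L^p`-solution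
`ψ(t)` of the nonlocal Fokker–Planck equation satisfies `ψ(t) > 0` for all `t ∈ (0, T_max)`. -/
theorem fokkerPlanck_positivity
    (m : ℕ) (V : Spc m → ℝ) (β σ p : ℝ) (ψ0 : Spc m → ℝ)
    (Tmax : ℝ≥0∞) (ψ : ℝ → Spc m → ℝ)
    (hV : ContDiff ℝ 2 V) (hVper : IsPeriodic V) (hβ : 0 < β)
    (h1 : Hyp1 σ p ψ0) (h2 : Hyp2 m σ p)
    (hψ : IsMaximalLpSolution V β σ p ψ0 Tmax ψ) :
    ∀ t ∈ Ioo0 Tmax, ∀ x : Spc m, 0 < ψ t x := by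
  intro t ht x
  have S := fp_sol h1 h2 hψ.1 ht
  have hn := fp_nonneg hβ hV hVper S
  have hV1 : ContDiff ℝ 1 V := hV.of_le (by norm_num)
  obtain ⟨C0, hC0, H0⟩ := fp_per_bdd (fp_per_pd hVper (e1 m)) (fp_pd_cont hV1 (e1 m))
  have hb := fun i => fp_per_bdd (fp_per_pd hVper (eC m i)) (fp_pd_cont hV1 (eC m i))
  choose C hC H using hb
  have hs : 0 ≤ ∑ i, C i := Finset.sum_nonneg fun i _ => hC i
  rw [← fp_per_fract (S.per t ⟨ht.1, le_rfl⟩) x]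
  refine fp_pos (M := C0 + ∑ i, C i) hβ hV hVper S hn (fun x => ?_) (fun i x => ?_) ht.1
    (fp_fract_mem x)
  · linarith [H0 x]
  · have := Finset.single_le_sum (f := C) (fun i _ => hC i) (Finset.mem_univ i)
    linarith [H i x]
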